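/- arXiv:2605.28304 — 10 statements merged into one kernel-verified Lean document; each statement's English description precedes it below -/
import Mathlib

section
/- Suppose the family of autoregressive models (p_1, …, p_k, p_b) over a finite vocabulary 𝒳, conditioned on an input x, satisfies factorized conditionals with partition (M_1, …, M_k, M_b) of the positions [ℓ]. Then the sequence-level law of the selective composition p̂ factorizes as p̂(y | x) = p_b(y_{M_b} | x) · ∏_{i=1}^k p_i(y_{M_i} | x) for every y ∈ 𝒳^ℓ. In particular, for every i the marginal of p̂(· | x) on the coordinates M_i equals the marginal of p_i(· | x) on M_i, so p̂ is a projective composition of (p_1, …, p_k, p_b) with respect to the projections Π_i(y) = y_{M_i}. -/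
/-!
STATEMENT 0: Correctness of composition under factorized conditionals.
An autoregressive model over a finite vocabulary `X` with generation length `ℓ`,
conditioned on an input `x`, is a family of strictly positive conditional pmfs on `X`,
one for each position `t : Fin ℓ` and prefix.  Under factorized conditionals with
partition `(M 0, …, M (k-1), Mb)` of the positions, the sequence-level law of the
selective composition factorizes as `p̂(y|x) = p_b(y_{M_b}|x) ∏ i, p_i(y_{M_i}|x)`,
and the marginal of `p̂` on each `M i` equals the marginal of `p i` (projective
composition with respect to the projections `y ↦ y_{M_i}`).
-/

namespace Stmt0

open Finset

/-- An autoregressive model over vocabulary `X` with generation length `ℓ`: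
for each position `t` and prefix of length `t`, a (conditional) distribution over
the next token. -/
def AR (X : Type*) (ℓ : ℕ) : Type _ :=
  (t : Fin ℓ) → (Fin t.1 → X) → X → ℝ

/-- The prefix `y_{<t}` of a full generation `y`. -/
def pref {X : Type*} {ℓ : ℕ} (y : Fin ℓ → X) (t : Fin ℓ) : Fin t.1 → X :=
  fun s => y ⟨s.1, s.2.trans t.2⟩

/-- The sequence-level law `p(y|x) = ∏ t, p(y_t | x, y_{<t})` of an autoregressive model. -/
def seqLaw {X : Type*} {ℓ : ℕ} (p : AR X ℓ) (y : Fin ℓ → X) : ℝ :=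
  ∏ t : Fin ℓ, p t (pref y t) (y t)

variable {X : Type*} [Fintype X] [DecidableEq X]

/-- The normalizing constant `Z_t(x, y_{<t})` of the selective composition. -/
noncomputable def Zt {ℓ k : ℕ} (pb : AR X ℓ) (p : Fin k → AR X ℓ)
    (t : Fin ℓ) (pre : Fin t.1 → X) : ℝ :=
  ∑ a : X, pb t pre a * ∏ i, p i t pre a / pb t pre a

/-- The selective composition
`p̂(y_t|x,y_{<t}) = Z_t⁻¹ · p_b(y_t|x,y_{<t}) ∏ i, p_i(y_t|x,y_{<t})/p_b(y_t|x,y_{<t})`. -/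
noncomputable def selComp {ℓ k : ℕ} (pb : AR X ℓ) (p : Fin k → AR X ℓ) : AR X ℓ :=
  fun t pre a => (pb t pre a * ∏ i, p i t pre a / pb t pre a) / Zt pb p t pre

/-- Restriction `y ↦ y_M` of a generation to an index set `M`. -/
def restr {ℓ : ℕ} (y : Fin ℓ → X) (M : Finset (Fin ℓ)) : M → X :=
  fun j => y j.1

/-- Marginal law of a distribution `q` on `𝒳^ℓ` on the coordinates in `M`
(the pushforward of `q` under `y ↦ y_M`). -/
noncomputable def marg {ℓ : ℕ} (q : (Fin ℓ → X) → ℝ) (M : Finset (Fin ℓ))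
    (w : M → X) : ℝ :=
  ∑ y : Fin ℓ → X, if ∀ j : M, y j.1 = w j then q y else 0

section Cylinder

variable {ι : Type*} [Fintype ι] [DecidableEq ι]

/-- The mass that `q` gives to the cylinder of functions agreeing with `y` on `C`. -/
def cylSum (q : (ι → X) → ℝ) (C : Finset ι) (y : ι → X) : ℝ :=
  ∑ z : ι → X with ∀ s ∈ C, z s = y s, q z

lemma cylSum_dependsOn (q : (ι → X) → ℝ) (C : Finset ι) :
    DependsOn (cylSum q C) (C : Set ι) := by
  intro y z h
  unfold cylSum
  congr 1
  ext w
  simp only [mem_filter, mem_univ, true_and]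
  exact forall₂_congr fun s hs => by rw [h s hs]

@[simp]
lemma cylSum_univ (q : (ι → X) → ℝ) (y : ι → X) : cylSum q univ y = q y := by
  have : (univ.filter fun z : ι → X => ∀ s ∈ univ, z s = y s) = {y} := by
    ext z
    simp [funext_iff]
  rw [cylSum, this, sum_singleton]

lemma cylSum_pos {q : (ι → X) → ℝ} (hq : ∀ z, 0 < q z) (C : Finset ι) (y : ι → X) :
    0 < cylSum q C y :=
  sum_pos (fun z _ => hq z) ⟨y, by simp⟩

/-- The cylinder sum of a product of a function of the coordinates in `A` and a function of the
other coordinates splits into the two partial sums. -/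
lemma cylSum_mul_of_dependsOn {f g : (ι → X) → ℝ} {A : Finset ι}
    (hf : DependsOn f (A : Set ι)) (hg : DependsOn g ((Aᶜ : Finset ι) : Set ι))
    (C : Finset ι) (y : ι → X) :
    cylSum (fun z => f z * g z) C y = cylSum f (C ∪ Aᶜ) y * cylSum g (C ∪ A) y := by
  unfold cylSum
  rw [sum_mul_sum, ← sum_product']
  refine sum_nbij' (fun z => (A.piecewise z y, A.piecewise y z))
    (fun w => A.piecewise w.1 w.2) ?_ ?_ ?_ ?_ ?_
  · intro z hz
    simp only [mem_filter, mem_univ, true_and, mem_product, mem_union, mem_compl] at hz ⊢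
    refine ⟨fun s hs => ?_, fun s hs => ?_⟩ <;> by_cases h : s ∈ A <;> simp_all
  · rintro ⟨u, v⟩ hw
    simp only [mem_filter, mem_univ, true_and, mem_product, mem_union, mem_compl] at hw ⊢
    intro s hs
    by_cases h : s ∈ A <;> simp_all
  · intro z _
    ext s
    by_cases h : s ∈ A <;> simp [h]
  · rintro ⟨u, v⟩ hw
    simp only [mem_filter, mem_univ, true_and, mem_product, mem_union, mem_compl] at hw
    refine Prod.ext (funext fun s => ?_) (funext fun s => ?_) <;>
      by_cases h : s ∈ A <;> simp_all
  · intro z _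
    refine congrArg₂ (· * ·) (hf fun s hs => ?_) (hg fun s hs => ?_)
    · simp [mem_coe.1 hs]
    · simp [mem_compl.1 (mem_coe.1 hs)]

/-- If a positive probability mass function is the product of its marginal on `A` and a function
of the other coordinates, then that marginal has total mass one. -/
lemma cylSum_compl_marginal_eq_one {q g : (ι → X) → ℝ} {A : Finset ι}
    (hpos : ∀ z, 0 < q z) (hone : ∀ y, cylSum q ∅ y = 1)
    (hg : DependsOn g ((Aᶜ : Finset ι) : Set ι))
    (hq : ∀ z, q z = cylSum q A z * g z) (y : ι → X) :
    cylSum (cylSum q A) Aᶜ y = 1 := by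
  have key (C : Finset ι) : cylSum q C y =
      cylSum (cylSum q A) (C ∪ Aᶜ) y * cylSum g (C ∪ A) y := by
    conv_lhs => rw [show q = fun z => cylSum q A z * g z from funext hq]
    exact cylSum_mul_of_dependsOn (cylSum_dependsOn q A) hg C y
  have hA := key A
  have h0 := key ∅
  rw [union_compl, cylSum_univ, union_self] at hA
  have hg1 : cylSum g A y = 1 :=
    (mul_eq_left₀ (cylSum_pos hpos A y).ne').1 hA.symm
  rw [hone, empty_union, empty_union, hg1, mul_one] at h0
  exact h0.symm

/-- If a positive probability mass function is the product of its marginal on `A` and a function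
of the other coordinates, then that function is its marginal on the complement of `A`. -/
lemma cylSum_compl_eq {q g : (ι → X) → ℝ} {A : Finset ι}
    (hpos : ∀ z, 0 < q z) (hone : ∀ y, cylSum q ∅ y = 1)
    (hg : DependsOn g ((Aᶜ : Finset ι) : Set ι))
    (hq : ∀ z, q z = cylSum q A z * g z) (y : ι → X) :
    cylSum q Aᶜ y = g y := by
  have h := cylSum_mul_of_dependsOn (cylSum_dependsOn q A) hg Aᶜ y
  rw [← show q = fun z => cylSum q A z * g z from funext hq, union_self,
    cylSum_compl_marginal_eq_one hpos hone hg hq, union_comm, union_compl, cylSum_univ,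
    one_mul] at h
  exact h

/-- If `f` is the product of functions of the coordinates in `A` and outside `A`, the first of
total mass one, and `f` has total mass one, then the marginal of `f` on `A` is the first factor. -/
lemma cylSum_eq_of_total {f g : (ι → X) → ℝ} {A : Finset ι}
    (hf : DependsOn f (A : Set ι)) (hg : DependsOn g ((Aᶜ : Finset ι) : Set ι))
    {y : ι → X} (hf1 : cylSum f Aᶜ y = 1) (hfg : cylSum (fun z => f z * g z) ∅ y = 1) :
    cylSum (fun z => f z * g z) A y = f y := by
  rw [cylSum_mul_of_dependsOn hf hg, empty_union, empty_union, hf1, one_mul] at hfg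
  rw [cylSum_mul_of_dependsOn hf hg, union_compl, cylSum_univ, union_self, hfg, mul_one]

/-- Summing out the value at a free coordinate. -/
lemma cylSum_eq_sum_update (q : (ι → X) → ℝ) {C : Finset ι} {t : ι} (ht : t ∉ C) (y : ι → X) :
    cylSum q C y = ∑ a : X, cylSum q (insert t C) (Function.update y t a) := by
  unfold cylSum
  rw [← sum_fiberwise _ (fun z : ι → X => z t) q]
  refine sum_congr rfl fun a _ => ?_
  rw [filter_filter]
  congr 1
  ext z
  simp only [mem_filter, mem_univ, true_and, forall_mem_insert, Function.update_self]
  rw [and_comm]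
  refine and_congr_right fun _ => forall₂_congr fun s hs => ?_
  rw [Function.update_of_ne (ne_of_mem_of_not_mem hs ht)]

end Cylinder

lemma marg_restr {ℓ : ℕ} (q : (Fin ℓ → X) → ℝ) (M : Finset (Fin ℓ)) (y : Fin ℓ → X) :
    marg q M (restr y M) = cylSum q M y := by
  rw [marg, cylSum, sum_filter]
  refine sum_congr rfl fun z _ => ?_
  have h : (∀ j : M, z j.1 = restr y M j) ↔ ∀ s ∈ M, z s = y s := by simp [restr]
  by_cases hz : ∀ s ∈ M, z s = y s
  · rw [if_pos (h.2 hz), if_pos hz]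
  · rw [if_neg (mt h.1 hz), if_neg hz]

section Prefix

variable {ℓ : ℕ}

/-- The positions before `n`. -/
def before (ℓ n : ℕ) : Finset (Fin ℓ) := univ.filter fun s => s.1 < n

lemma mem_before {n : ℕ} {s : Fin ℓ} : s ∈ before ℓ n ↔ s.1 < n := by
  simp [before]

lemma before_succ (t : Fin ℓ) : before ℓ (t.1 + 1) = insert t (before ℓ t.1) := by
  ext s
  simp only [mem_before, mem_insert, Fin.ext_iff]
  omega

lemma cylSum_before (p : AR X ℓ) (hsum : ∀ t pre, ∑ a : X, p t pre a = 1)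
    {n : ℕ} (hn : n ≤ ℓ) (y : Fin ℓ → X) :
    cylSum (seqLaw p) (before ℓ n) y = ∏ s ∈ before ℓ n, p s (pref y s) (y s) := by
  induction hn using Nat.decreasingInduction generalizing y with
  | self =>
    have : before ℓ ℓ = univ := by ext s; simp [mem_before]
    rw [this, cylSum_univ, seqLaw]
  | of_succ n hn ih =>
    have ht : (⟨n, hn⟩ : Fin ℓ) ∉ before ℓ n := by simp [mem_before]
    have hs := before_succ (⟨n, hn⟩ : Fin ℓ)
    simp only at hs
    rw [cylSum_eq_sum_update _ ht]
    have step (a : X) : cylSum (seqLaw p) (insert ⟨n, hn⟩ (before ℓ n))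
        (Function.update y ⟨n, hn⟩ a) =
        p ⟨n, hn⟩ (pref y ⟨n, hn⟩) a * ∏ s ∈ before ℓ n, p s (pref y s) (y s) := by
      have hpref (s : Fin ℓ) (hsn : s.1 ≤ n) :
          pref (Function.update y ⟨n, hn⟩ a) s = pref y s := by
        funext r
        exact Function.update_of_ne (by simp only [ne_eq, Fin.ext_iff]; omega) _ _
      rw [← hs, ih, hs, prod_insert ht, hpref _ le_rfl, Function.update_self]
      congr 1
      refine prod_congr rfl fun s hs => ?_
      rw [mem_before] at hs
      rw [hpref s hs.le, Function.update_of_ne (by simp only [ne_eq, Fin.ext_iff]; omega)]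
    simp_rw [step]
    rw [← sum_mul, hsum, one_mul]

lemma cylSum_seqLaw_empty (p : AR X ℓ) (hsum : ∀ t pre, ∑ a : X, p t pre a = 1)
    (y : Fin ℓ → X) : cylSum (seqLaw p) ∅ y = 1 := by
  have h := cylSum_before p hsum (Nat.zero_le ℓ) y
  simpa [before] using h

lemma cylSum_before_succ (p : AR X ℓ) (hsum : ∀ t pre, ∑ a : X, p t pre a = 1)
    (t : Fin ℓ) (y : Fin ℓ → X) :
    cylSum (seqLaw p) (insert t (before ℓ t.1)) y =
      cylSum (seqLaw p) (before ℓ t.1) y * p t (pref y t) (y t) := by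
  rw [cylSum_before p hsum t.2.le, ← before_succ, cylSum_before p hsum t.2, before_succ,
    prod_insert (by simp [mem_before]), mul_comm]

lemma seqLaw_pos {X : Type*} {p : AR X ℓ} (hpos : ∀ t pre a, 0 < p t pre a) (y : Fin ℓ → X) :
    0 < seqLaw p y :=
  prod_pos fun _ _ => hpos _ _ _

/-- Two autoregressive models whose laws share the factor on the complement of `A` have the same
conditionals at the positions outside `A`. -/
lemma conditional_eq_of_notMem {p q : AR X ℓ}
    (hppos : ∀ t pre a, 0 < p t pre a) (hpsum : ∀ t pre, ∑ a : X, p t pre a = 1)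
    (hqpos : ∀ t pre a, 0 < q t pre a) (hqsum : ∀ t pre, ∑ a : X, q t pre a = 1)
    {A : Finset (Fin ℓ)} {f h g : (Fin ℓ → X) → ℝ}
    (hf : DependsOn f (A : Set (Fin ℓ))) (hh : DependsOn h (A : Set (Fin ℓ)))
    (hg : DependsOn g ((Aᶜ : Finset (Fin ℓ)) : Set (Fin ℓ)))
    (hp : ∀ y, seqLaw p y = f y * g y) (hq : ∀ y, seqLaw q y = h y * g y)
    {t : Fin ℓ} (ht : t ∉ A) (pre : Fin t.1 → X) (a : X) :
    p t pre a = q t pre a := by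
  obtain ⟨y, rfl, rfl⟩ : ∃ y : Fin ℓ → X, pref y t = pre ∧ y t = a :=
    ⟨fun s => if hs : s.1 < t.1 then pre ⟨s.1, hs⟩ else a, by funext r; simp [pref], by simp⟩
  have hC : insert t (before ℓ t.1) ∪ Aᶜ = before ℓ t.1 ∪ Aᶜ := by
    rw [insert_union, insert_eq_of_mem (mem_union_right _ (mem_compl.2 ht))]
  have p0 := cylSum_pos (seqLaw_pos hppos) (before ℓ t.1) y
  have q0 := cylSum_pos (seqLaw_pos hqpos) (before ℓ t.1) y
  have p1 := cylSum_before_succ p hpsum t y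
  have q1 := cylSum_before_succ q hqsum t y
  rw [show seqLaw p = fun z => f z * g z from funext hp] at p0 p1
  rw [show seqLaw q = fun z => h z * g z from funext hq] at q0 q1
  simp only [cylSum_mul_of_dependsOn hf hg, cylSum_mul_of_dependsOn hh hg, hC] at p0 p1 q0 q1
  rw [mul_assoc] at p1 q1
  have p2 := mul_left_cancel₀ (left_ne_zero_of_mul p0.ne') p1
  have q2 := mul_left_cancel₀ (left_ne_zero_of_mul q0.ne') q1
  exact mul_left_cancel₀ (right_ne_zero_of_mul p0.ne') (p2.symm.trans q2)

/-- The law of a selective composition whose normalizing constants are all one. -/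
lemma seqLaw_selComp_of_Zt_eq_one {X : Type*} [Fintype X] {k : ℕ} {pb : AR X ℓ}
    {p : Fin k → AR X ℓ} (hZ : ∀ t pre, Zt pb p t pre = 1) (y : Fin ℓ → X) :
    seqLaw (selComp pb p) y = seqLaw pb y * ∏ i, seqLaw (p i) y / seqLaw pb y := by
  simp only [seqLaw, selComp, hZ, div_one, prod_mul_distrib, ← prod_div_distrib]
  rw [prod_comm]

lemma sum_selComp {X : Type*} [Fintype X] {k : ℕ} {pb : AR X ℓ}
    {p : Fin k → AR X ℓ} (hZ : ∀ t pre, Zt pb p t pre = 1) (t : Fin ℓ) (pre : Fin t.1 → X) :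
    ∑ a, selComp pb p t pre a = 1 := by
  simp only [selComp, hZ, div_one]
  exact hZ t pre

end Prefix

/-- **Correctness of Composition** (Theorem 3.1). -/
theorem correctness_of_composition
    {Inp : Type*} (x : Inp) {ℓ k : ℕ}
    (pb : Inp → AR X ℓ) (p : Fin k → Inp → AR X ℓ)
    -- the models are strictly positive conditional pmfs
    (hbpos : ∀ t pre a, 0 < pb x t pre a)
    (hbsum : ∀ t pre, ∑ a : X, pb x t pre a = 1)
    (hpos : ∀ i t pre a, 0 < p i x t pre a)
    (hsum : ∀ i t pre, ∑ a : X, p i x t pre a = 1)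
    -- `(M 0, …, M (k-1), Mb)` is a partition of the positions `[ℓ]`
    (M : Fin k → Finset (Fin ℓ)) (Mb : Finset (Fin ℓ))
    (hdisj : ∀ i j, i ≠ j → Disjoint (M i) (M j))
    (hdisjb : ∀ i, Disjoint (M i) Mb)
    (hcover : ∀ t : Fin ℓ, t ∈ Mb ∨ ∃ i, t ∈ M i)
    -- factorized conditionals: `p_i(y|x) = p_i(y_{M_i}|x) · p_b(y_{M_i^c}|x)`
    (hfac : ∀ i (y : Fin ℓ → X), seqLaw (p i x) y =
      marg (seqLaw (p i x)) (M i) (restr y (M i)) *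
      marg (seqLaw (pb x)) (M i)ᶜ (restr y (M i)ᶜ))
    -- and `p_b(y|x) = p_b(y_{M_b}|x) · ∏ i, p_b(y_{M_i}|x)`
    (hfacb : ∀ y : Fin ℓ → X, seqLaw (pb x) y =
      marg (seqLaw (pb x)) Mb (restr y Mb) *
      ∏ i, marg (seqLaw (pb x)) (M i) (restr y (M i))) :
    -- the sequence-level law of the selective composition factorizes, ...
    (∀ y : Fin ℓ → X,
      seqLaw (selComp (pb x) (fun i => p i x)) y =
        marg (seqLaw (pb x)) Mb (restr y Mb) *
        ∏ i, marg (seqLaw (p i x)) (M i) (restr y (M i))) ∧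
    -- ... and `p̂` is a projective composition w.r.t. the projections `Π_i(y) = y_{M_i}`:
    (∀ i (w : M i → X),
      marg (seqLaw (selComp (pb x) (fun i => p i x))) (M i) w =
        marg (seqLaw (p i x)) (M i) w) := by
  simp only [marg_restr] at hfac hfacb ⊢
  have hsub {i j : Fin k} (hij : j ≠ i) : (M j : Set (Fin ℓ)) ⊆ ((M i)ᶜ : Finset (Fin ℓ)) :=
    coe_subset.2 fun s hs => mem_compl.2 (disjoint_left.1 (hdisj j i hij) hs)
  have hsubb (i : Fin k) : (Mb : Set (Fin ℓ)) ⊆ ((M i)ᶜ : Finset (Fin ℓ)) :=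
    coe_subset.2 fun s hs => mem_compl.2 (disjoint_right.1 (hdisjb i) hs)
  have hrest (i : Fin k) (q : Fin k → (Fin ℓ → X) → ℝ) :
      DependsOn (fun y => cylSum (seqLaw (pb x)) Mb y *
        ∏ j ∈ univ.erase i, cylSum (q j) (M j) y)
        (((M i)ᶜ : Finset (Fin ℓ)) : Set (Fin ℓ)) := by
    intro y z h
    refine congrArg₂ (· * ·)
      (cylSum_dependsOn _ Mb fun s hs => h s (hsubb i hs)) (prod_congr rfl fun j hj => ?_)
    exact cylSum_dependsOn _ (M j) fun s hs => h s (hsub (ne_of_mem_erase hj) hs)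
  have hsplit (i : Fin k) (c : ℝ) (u : Fin k → ℝ) :
      c * ∏ j, u j = u i * (c * ∏ j ∈ univ.erase i, u j) := by
    rw [← mul_prod_erase univ u (mem_univ i), mul_left_comm]
  have hb (i : Fin k) (y : Fin ℓ → X) : seqLaw (pb x) y =
      cylSum (seqLaw (pb x)) (M i) y * cylSum (seqLaw (pb x)) (M i)ᶜ y := by
    have hq (z : Fin ℓ → X) := (hfacb z).trans (hsplit i _ _)
    rw [cylSum_compl_eq (seqLaw_pos hbpos) (cylSum_seqLaw_empty _ hbsum)
      (hrest i fun _ => seqLaw (pb x)) hq]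
    exact hq y
  have hcond (i : Fin k) {t : Fin ℓ} (ht : t ∉ M i) (pre : Fin t.1 → X) (a : X) :
      p i x t pre a = pb x t pre a :=
    conditional_eq_of_notMem (hpos i) (hsum i) hbpos hbsum (cylSum_dependsOn _ _)
      (cylSum_dependsOn _ _) (cylSum_dependsOn _ _) (hfac i) (hb i) ht pre a
  have hZ (t : Fin ℓ) (pre : Fin t.1 → X) : Zt (pb x) (fun i => p i x) t pre = 1 := by
    unfold Zt
    rcases hcover t with ht | ⟨j, hj⟩
    · rw [← hbsum t pre]
      refine sum_congr rfl fun a _ => ?_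
      rw [prod_eq_one, mul_one]
      intro i _
      change p i x t pre a / pb x t pre a = 1
      rw [hcond i (disjoint_right.1 (hdisjb i) ht), div_self (hbpos t pre a).ne']
    · rw [← hsum j t pre]
      refine sum_congr rfl fun a _ => ?_
      rw [prod_eq_single j, mul_div_cancel₀ _ (hbpos t pre a).ne']
      · intro i _ hij
        change p i x t pre a / pb x t pre a = 1
        rw [hcond i (disjoint_right.1 (hdisj i j hij) hj), div_self (hbpos t pre a).ne']
      · simp
  have hlaw (y : Fin ℓ → X) : seqLaw (selComp (pb x) (fun i => p i x)) y =
      cylSum (seqLaw (pb x)) Mb y * ∏ i, cylSum (seqLaw (p i x)) (M i) y := by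
    have hbp := cylSum_pos (seqLaw_pos hbpos)
    have hratio (i : Fin k) : seqLaw (p i x) y / seqLaw (pb x) y =
        cylSum (seqLaw (p i x)) (M i) y / cylSum (seqLaw (pb x)) (M i) y := by
      rw [hfac i y, hb i y, mul_div_mul_right _ _ (hbp _ y).ne']
    rw [seqLaw_selComp_of_Zt_eq_one hZ]
    simp only [hratio]
    rw [hfacb y, prod_div_distrib, mul_assoc, mul_div_cancel₀]
    exact prod_ne_zero_iff.2 fun i _ => (hbp _ y).ne'
  refine ⟨hlaw, fun i w => ?_⟩
  have hX (s : Fin ℓ) : Nonempty X := by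
    by_contra hne
    rw [not_nonempty_iff] at hne
    simpa using hbsum ⟨0, s.pos⟩ (fun r => r.elim0)
  obtain ⟨y, rfl⟩ : ∃ y : Fin ℓ → X, restr y (M i) = w :=
    ⟨fun s => if hs : s ∈ M i then w ⟨s, hs⟩ else (hX s).some, by funext s; simp [restr]⟩
  rw [marg_restr, marg_restr]
  have hq (z : Fin ℓ → X) := (hlaw z).trans (hsplit i _ _)
  have htot := cylSum_seqLaw_empty _ (sum_selComp hZ) y
  rw [funext hq] at htot ⊢
  exact cylSum_eq_of_total (cylSum_dependsOn _ _) (hrest i fun j => seqLaw (p j x))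
    (cylSum_compl_marginal_eq_one (seqLaw_pos (hpos i)) (cylSum_seqLaw_empty _ (hsum i))
      (cylSum_dependsOn _ _) (hfac i) y) htot

end Stmt0
end

section
/- Suppose the family of autoregressive models (p_1, …, p_k, p_b) over a finite vocabulary 𝒳, conditioned on an input x, satisfies factorized conditionals with partition (M_1, …, M_k, M_b) of the positions [ℓ]. Then for every i ∈ {1,…,k}, every position t ∉ M_i, every prefix y_{<t} ∈ 𝒳^{t-1}, and every token y_t ∈ 𝒳, the autoregressive conditional of p_i agrees with that of the background model: p_i(y_t | x, y_{<t}) = p_b(y_t | x, y_{<t}). -/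
/-!
STATEMENT 1: Under factorized conditionals, each specialized model `p i` agrees with the
background model `p_b` on its autoregressive conditionals at every position `t ∉ M i`,
for every prefix and token.
-/

namespace Stmt1

open Finset

/-- An autoregressive model over vocabulary `X` with generation length `ℓ`. -/
def AR (X : Type*) (ℓ : ℕ) : Type _ :=
  (t : Fin ℓ) → (Fin t.1 → X) → X → ℝ

/-- The prefix `y_{<t}` of a full generation `y`. -/
def pref {X : Type*} {ℓ : ℕ} (y : Fin ℓ → X) (t : Fin ℓ) : Fin t.1 → X :=
  fun s => y ⟨s.1, s.2.trans t.2⟩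

/-- The sequence-level law `p(y|x) = ∏ t, p(y_t | x, y_{<t})`. -/
def seqLaw {X : Type*} {ℓ : ℕ} (p : AR X ℓ) (y : Fin ℓ → X) : ℝ :=
  ∏ t : Fin ℓ, p t (pref y t) (y t)

variable {X : Type*} [Fintype X] [DecidableEq X]

/-- Restriction `y ↦ y_M` of a generation to an index set `M`. -/
def restr {ℓ : ℕ} (y : Fin ℓ → X) (M : Finset (Fin ℓ)) : M → X :=
  fun j => y j.1

/-- Marginal law of a distribution `q` on `𝒳^ℓ` on the coordinates in `M`. -/
noncomputable def marg {ℓ : ℕ} (q : (Fin ℓ → X) → ℝ) (M : Finset (Fin ℓ))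
    (w : M → X) : ℝ :=
  ∑ y : Fin ℓ → X, if ∀ j : M, y j.1 = w j then q y else 0

/-- `f` does not depend on the coordinates in `S`. -/
def IndepOf {ι X R : Type*} [DecidableEq ι] (f : (ι → X) → R) (S : Set ι) : Prop :=
  ∀ t ∈ S, ∀ y a, f (Function.update y t a) = f y

/-- The law `∏ s < n, p(y_s | x, y_{<s})` of the first `n` tokens. -/
def prefixLaw {X : Type*} {ℓ : ℕ} (p : AR X ℓ) (n : ℕ) (y : Fin ℓ → X) : ℝ :=
  ∏ s ∈ univ.filter (fun s : Fin ℓ => s.1 < n), p s (pref y s) (y s)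

section PrefixLaw

variable {X : Type*} {ℓ : ℕ} (p : AR X ℓ)

theorem prefixLaw_length (y : Fin ℓ → X) : prefixLaw p ℓ y = seqLaw p y := by
  simp [prefixLaw, seqLaw]

theorem prefixLaw_succ (t : Fin ℓ) (y : Fin ℓ → X) :
    prefixLaw p (t.1 + 1) y = p t (pref y t) (y t) * prefixLaw p t.1 y := by
  have h : univ.filter (fun s : Fin ℓ => s.1 < t.1 + 1) =
      insert t (univ.filter (fun s : Fin ℓ => s.1 < t.1)) := by
    ext s
    simp [Fin.ext_iff]
    omega
  rw [prefixLaw, h, prod_insert (by simp), prefixLaw]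

theorem prefixLaw_pos (hpos : ∀ t pre a, 0 < p t pre a) (n : ℕ) (y : Fin ℓ → X) :
    0 < prefixLaw p n y :=
  prod_pos fun _ _ => hpos _ _ _

theorem pref_update_of_le (y : Fin ℓ → X) {s t : Fin ℓ} (h : s ≤ t) (a : X) :
    pref (Function.update y t a) s = pref y s := by
  funext r
  refine Function.update_of_ne ?_ _ _
  have := r.2
  simp only [ne_eq, Fin.ext_iff, Fin.le_def] at *
  omega

theorem prefixLaw_update (t : Fin ℓ) (y : Fin ℓ → X) (a : X) :
    prefixLaw p t.1 (Function.update y t a) = prefixLaw p t.1 y := by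
  refine prod_congr rfl fun s hs => ?_
  have hst : s < t := by simpa using hs
  rw [pref_update_of_le y hst.le, Function.update_of_ne hst.ne]

theorem sum_prefixLaw_update [Fintype X] (hsum : ∀ t pre, ∑ a : X, p t pre a = 1)
    (t : Fin ℓ) (y : Fin ℓ → X) :
    ∑ a, prefixLaw p (t.1 + 1) (Function.update y t a) = prefixLaw p t.1 y := by
  simp only [prefixLaw_succ, prefixLaw_update, pref_update_of_le y le_rfl,
    Function.update_self, ← sum_mul, hsum, one_mul]

end PrefixLaw

section IndepOf

variable {ι X R : Type*} [DecidableEq ι]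

theorem IndepOf.mul [Mul R] {f g : (ι → X) → R} {S : Set ι} (hf : IndepOf f S)
    (hg : IndepOf g S) : IndepOf (fun y => f y * g y) S := fun t ht y a => by
  simp only [hf t ht, hg t ht]

theorem IndepOf.prod [CommMonoid R] {κ : Type*} {s : Finset κ} {f : κ → (ι → X) → R}
    {S : Set ι} (hf : ∀ j ∈ s, IndepOf (f j) S) : IndepOf (fun y => ∏ j ∈ s, f j y) S :=
  fun t ht y a => prod_congr rfl fun j hj => hf j hj t ht y a

theorem IndepOf.sum_update [Fintype X] [AddCommMonoid R] {f : (ι → X) → R} {S : Set ι}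
    (hf : IndepOf f S) (t : ι) : IndepOf (fun y => ∑ a, f (Function.update y t a)) S := by
  intro s hs y b
  refine sum_congr rfl fun a _ => ?_
  by_cases hst : s = t
  · subst hst
    simp
  · rw [Function.update_comm hst, hf s hs]

theorem IndepOf.eq_of_agree [Finite ι] {f : (ι → X) → R} {S : Set ι} (hf : IndepOf f S)
    {y z : ι → X} (h : ∀ j ∉ S, y j = z j) : f y = f z := by
  classical
  cases nonempty_fintype ι
  have key : ∀ T : Finset ι, (∀ t ∈ T, t ∈ S) →
      f (fun j => if j ∈ T then z j else y j) = f y := by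
    intro T
    induction T using Finset.induction_on with
    | empty => simp
    | insert t T _ ih =>
      intro hT
      rw [← ih fun s hs => hT s (mem_insert_of_mem hs),
        ← hf t (hT t (mem_insert_self t T)) (fun j => if j ∈ T then z j else y j) (z t)]
      congr 1
      funext j
      by_cases hj : j = t
      · subst hj
        simp
      · simp [hj]
  rw [← key (univ.filter (· ∈ S)) (by simp)]
  congr 1
  funext j
  by_cases hj : j ∈ S
  · simp [hj]
  · simp [hj, h j hj]

/-- The sum of `f` over the points agreeing with `y` on `S` does not depend on
coordinates that `f` does not depend on. -/
theorem IndepOf.sum_agree [Fintype ι] [Fintype X] [DecidableEq X] [AddCommMonoid R]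
    {f : (ι → X) → R} {S : Finset ι} (hf : IndepOf f S) :
    IndepOf (fun y => ∑ z : ι → X with ∀ j ∈ S, z j = y j, f z) S := by
  intro t ht y a
  refine sum_nbij' (fun z => Function.update z t (y t)) (fun z => Function.update z t a)
    ?_ ?_ ?_ ?_ fun z _ => (hf t ht z _).symm
  · intro z hz
    simp only [mem_filter, mem_univ, true_and] at hz ⊢
    intro j hj
    by_cases hjt : j = t
    · subst hjt
      simp
    · simpa [hjt] using hz j hj
  · intro z hz
    simp only [mem_filter, mem_univ, true_and] at hz ⊢
    intro j hj
    by_cases hjt : j = t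
    · subst hjt
      simp
    · simpa [hjt] using hz j hj
  · intro z hz
    simp only [mem_filter, mem_univ, true_and] at hz
    have := hz t ht
    simp_all
  · intro z hz
    simp only [mem_filter, mem_univ, true_and] at hz
    have := hz t ht
    simp_all

end IndepOf

theorem marg_restr {X : Type*} [Fintype X] [DecidableEq X] {ℓ : ℕ} (q : (Fin ℓ → X) → ℝ)
    (M : Finset (Fin ℓ)) (y : Fin ℓ → X) :
    marg q M (restr y M) = ∑ z : Fin ℓ → X with ∀ j ∈ M, z j = y j, q z := by
  simp [marg, restr, sum_filter]

theorem indepOf_marg_restr {X : Type*} [Fintype X] [DecidableEq X] {ℓ : ℕ}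
    (q : (Fin ℓ → X) → ℝ) {M : Finset (Fin ℓ)} {S : Set (Fin ℓ)} (h : ∀ t ∈ S, t ∉ M) :
    IndepOf (fun y => marg q M (restr y M)) S := by
  intro t ht y a
  have : restr (Function.update y t a) M = restr y M := by
    funext j
    exact Function.update_of_ne (fun hj => h t ht (by rw [← hj]; exact j.2)) _ _
  simp only [this]

/-- The laws of `p` and `q` on the first `n` tokens split over `M` and its complement,
with a common factor on the complement. -/
def CommonSplit {X : Type*} {ℓ : ℕ} (p q : AR X ℓ) (M : Finset (Fin ℓ)) (n : ℕ) : Prop :=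
  ∃ A A' B : (Fin ℓ → X) → ℝ,
    IndepOf A (M : Set (Fin ℓ))ᶜ ∧ IndepOf A' (M : Set (Fin ℓ))ᶜ ∧ IndepOf B M ∧
    (∀ y, prefixLaw p n y = A y * B y) ∧ ∀ y, prefixLaw q n y = A' y * B y

section CommonSplit

variable {X : Type*} [Fintype X] {ℓ : ℕ} {p q : AR X ℓ} {M : Finset (Fin ℓ)}

theorem CommonSplit.of_succ (hp : ∀ t pre, ∑ a : X, p t pre a = 1)
    (hq : ∀ t pre, ∑ a : X, q t pre a = 1) {t : Fin ℓ} (h : CommonSplit p q M (t.1 + 1)) :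
    CommonSplit p q M t.1 := by
  obtain ⟨A, A', B, hA, hA', hB, h1, h2⟩ := h
  by_cases ht : t ∈ M
  · refine ⟨_, _, B, hA.sum_update t, hA'.sum_update t, hB, fun y => ?_, fun y => ?_⟩
    · simp only [← sum_prefixLaw_update p hp, h1, hB t ht, sum_mul]
    · simp only [← sum_prefixLaw_update q hq, h2, hB t ht, sum_mul]
  · refine ⟨A, A', _, hA, hA', hB.sum_update t, fun y => ?_, fun y => ?_⟩
    · simp only [← sum_prefixLaw_update p hp, h1, hA t ht, mul_sum]
    · simp only [← sum_prefixLaw_update q hq, h2, hA' t ht, mul_sum]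

theorem CommonSplit.of_length (hp : ∀ t pre, ∑ a : X, p t pre a = 1)
    (hq : ∀ t pre, ∑ a : X, q t pre a = 1) (h : CommonSplit p q M ℓ) {n : ℕ} (hn : n ≤ ℓ) :
    CommonSplit p q M n :=
  Nat.decreasingInduction (motive := fun m _ => CommonSplit p q M m)
    (fun m hm ih => CommonSplit.of_succ hp hq (t := ⟨m, hm⟩) ih) h hn

theorem CommonSplit.conditional_eq (hppos : ∀ t pre a, 0 < p t pre a)
    (hqpos : ∀ t pre a, 0 < q t pre a) (hp : ∀ t pre, ∑ a : X, p t pre a = 1)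
    (hq : ∀ t pre, ∑ a : X, q t pre a = 1) {t : Fin ℓ} (ht : t ∉ M)
    (h : CommonSplit p q M (t.1 + 1)) (y : Fin ℓ → X) :
    p t (pref y t) (y t) = q t (pref y t) (y t) := by
  obtain ⟨A, A', B, hA, hA', -, h1, h2⟩ := h
  have cond : ∀ (r : AR X ℓ) (C : (Fin ℓ → X) → ℝ), (∀ t pre a, 0 < r t pre a) →
      (∀ t pre, ∑ a : X, r t pre a = 1) → IndepOf C (M : Set (Fin ℓ))ᶜ →
      (∀ y, prefixLaw r (t.1 + 1) y = C y * B y) →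
      r t (pref y t) (y t) = B y / ∑ a, B (Function.update y t a) := by
    intro r C hrpos hr hC h
    have hsum : prefixLaw r t.1 y = C y * ∑ a, B (Function.update y t a) := by
      simp only [← sum_prefixLaw_update r hr, h, hC t ht, mul_sum]
    have hne := (prefixLaw_pos r hrpos t.1 y).ne'
    have hsucc := prefixLaw_succ r t y
    rw [h, hsum] at hsucc
    rw [hsum] at hne
    rw [eq_div_iff (right_ne_zero_of_mul hne)]
    refine mul_left_cancel₀ (left_ne_zero_of_mul hne) ?_
    linear_combination -hsucc
  rw [cond p A hppos hp hA h1, cond q A' hqpos hq hA' h2]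

end CommonSplit

/-- Off its own mask, each specialized model's conditionals agree with the background. -/
theorem conditionals_agree_off_mask
    {Inp : Type*} (x : Inp) {ℓ k : ℕ}
    (pb : Inp → AR X ℓ) (p : Fin k → Inp → AR X ℓ)
    -- the models are strictly positive conditional pmfs
    (hbpos : ∀ t pre a, 0 < pb x t pre a)
    (hbsum : ∀ t pre, ∑ a : X, pb x t pre a = 1)
    (hpos : ∀ i t pre a, 0 < p i x t pre a)
    (hsum : ∀ i t pre, ∑ a : X, p i x t pre a = 1)
    -- `(M 0, …, M (k-1), Mb)` is a partition of the positions `[ℓ]`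
    (M : Fin k → Finset (Fin ℓ)) (Mb : Finset (Fin ℓ))
    (hdisj : ∀ i j, i ≠ j → Disjoint (M i) (M j))
    (hdisjb : ∀ i, Disjoint (M i) Mb)
    (hcover : ∀ t : Fin ℓ, t ∈ Mb ∨ ∃ i, t ∈ M i)
    -- factorized conditionals: `p_i(y|x) = p_i(y_{M_i}|x) · p_b(y_{M_i^c}|x)`
    (hfac : ∀ i (y : Fin ℓ → X), seqLaw (p i x) y =
      marg (seqLaw (p i x)) (M i) (restr y (M i)) *
      marg (seqLaw (pb x)) (M i)ᶜ (restr y (M i)ᶜ))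
    -- and `p_b(y|x) = p_b(y_{M_b}|x) · ∏ i, p_b(y_{M_i}|x)`
    (hfacb : ∀ y : Fin ℓ → X, seqLaw (pb x) y =
      marg (seqLaw (pb x)) Mb (restr y Mb) *
      ∏ i, marg (seqLaw (pb x)) (M i) (restr y (M i))) :
    ∀ (i : Fin k) (t : Fin ℓ), t ∉ M i → ∀ (pre : Fin t.1 → X) (a : X),
      p i x t pre a = pb x t pre a := by
  intro i t ht pre a
  set A := fun y : Fin ℓ → X => marg (seqLaw (p i x)) (M i) (restr y (M i))
  set C := fun y : Fin ℓ → X => marg (seqLaw (pb x)) (M i) (restr y (M i))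
  set D := fun y : Fin ℓ → X => marg (seqLaw (pb x)) Mb (restr y Mb) *
    ∏ j ∈ univ.erase i, marg (seqLaw (pb x)) (M j) (restr y (M j))
  have hA : IndepOf A (M i : Set (Fin ℓ))ᶜ := indepOf_marg_restr _ fun s hs => by simpa using hs
  have hC : IndepOf C (M i : Set (Fin ℓ))ᶜ := indepOf_marg_restr _ fun s hs => by simpa using hs
  have hD : IndepOf D (M i) :=
    (indepOf_marg_restr _ fun s hs => disjoint_left.1 (hdisjb i) hs).mul
      (IndepOf.prod fun j hj => indepOf_marg_restr _ fun s hs =>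
        disjoint_left.1 (hdisj i j (ne_of_mem_erase hj).symm) hs)
  have hb : ∀ y, seqLaw (pb x) y = C y * D y := fun y => by
    rw [hfacb, ← mul_prod_erase univ _ (mem_univ i)]
    ring
  have hK : IndepOf (fun y => ∑ z : Fin ℓ → X with ∀ j ∈ (M i)ᶜ, z j = y j, C z)
      (M i : Set (Fin ℓ))ᶜ := by
    rw [← coe_compl] at hC ⊢
    convert hC.sum_agree
  have hi : ∀ y, seqLaw (p i x) y =
      (A y * ∑ z : Fin ℓ → X with ∀ j ∈ (M i)ᶜ, z j = y j, C z) * D y := fun y => by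
    rw [hfac, marg_restr (seqLaw (pb x)), mul_assoc, sum_mul]
    congr 1
    refine sum_congr rfl fun z hz => ?_
    rw [hb, hD.eq_of_agree fun j hj => (mem_filter.1 hz).2 j (by simpa using hj)]
  have hsplit : CommonSplit (p i x) (pb x) (M i) ℓ :=
    ⟨_, C, D, hA.mul hK, hC, hD, fun y => (prefixLaw_length _ y).trans (hi y),
      fun y => (prefixLaw_length _ y).trans (hb y)⟩
  have key := (hsplit.of_length (hsum i) hbsum t.2).conditional_eq (hpos i) hbpos (hsum i) hbsum
    ht (fun s => if h : s.1 < t.1 then pre ⟨s.1, h⟩ else a)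
  have hpre : pref (fun s : Fin ℓ => if h : s.1 < t.1 then pre ⟨s.1, h⟩ else a) t = pre := by
    funext s
    simp [pref]
  rw [hpre] at key
  simpa using key

end Stmt1
end

section
/- Suppose the family of autoregressive models (p_1, …, p_k, p_b) over a finite vocabulary 𝒳, conditioned on an input x, satisfies factorized conditionals with partition (M_1, …, M_k, M_b) of the positions [ℓ]. For t ∈ [ℓ], let m(t) ∈ {1,…,k,b} denote the unique block index with t ∈ M_{m(t)}. Then for every position t and every prefix y_{<t}, the normalizing constant of the selective composition equals one, Z_t(x, y_{<t}) = 1, and the composed conditional equals the conditional of the active model: p̂(y_t | x, y_{<t}) = p_{m(t)}(y_t | x, y_{<t}) for all y_t ∈ 𝒳. -/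
/-!
STATEMENT 2: Under factorized conditionals, the normalizing constant of the selective
composition equals one at every position and prefix, and the composed conditional equals
the conditional of the unique active model: `p̂(y_t|x,y_{<t}) = p_{m(t)}(y_t|x,y_{<t})`,
where `m(t)` is the unique block (some `M i` or `M_b`) containing `t`.
-/

namespace Stmt2

open Finset

/-- An autoregressive model over vocabulary `X` with generation length `ℓ`. -/
def AR (X : Type*) (ℓ : ℕ) : Type _ :=
  (t : Fin ℓ) → (Fin t.1 → X) → X → ℝ

/-- The prefix `y_{<t}` of a full generation `y`. -/
def pref {X : Type*} {ℓ : ℕ} (y : Fin ℓ → X) (t : Fin ℓ) : Fin t.1 → X :=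
  fun s => y ⟨s.1, s.2.trans t.2⟩

/-- The sequence-level law `p(y|x) = ∏ t, p(y_t | x, y_{<t})`. -/
def seqLaw {X : Type*} {ℓ : ℕ} (p : AR X ℓ) (y : Fin ℓ → X) : ℝ :=
  ∏ t : Fin ℓ, p t (pref y t) (y t)

variable {X : Type*} [Fintype X] [DecidableEq X]

/-- The normalizing constant `Z_t(x, y_{<t})` of the selective composition. -/
noncomputable def Zt {ℓ k : ℕ} (pb : AR X ℓ) (p : Fin k → AR X ℓ)
    (t : Fin ℓ) (pre : Fin t.1 → X) : ℝ :=
  ∑ a : X, pb t pre a * ∏ i, p i t pre a / pb t pre a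

/-- The selective composition. -/
noncomputable def selComp {ℓ k : ℕ} (pb : AR X ℓ) (p : Fin k → AR X ℓ) : AR X ℓ :=
  fun t pre a => (pb t pre a * ∏ i, p i t pre a / pb t pre a) / Zt pb p t pre

/-- Restriction `y ↦ y_M` of a generation to an index set `M`. -/
def restr {ℓ : ℕ} (y : Fin ℓ → X) (M : Finset (Fin ℓ)) : M → X :=
  fun j => y j.1

/-- Marginal law of a distribution `q` on `𝒳^ℓ` on the coordinates in `M`. -/
noncomputable def marg {ℓ : ℕ} (q : (Fin ℓ → X) → ℝ) (M : Finset (Fin ℓ))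
    (w : M → X) : ℝ :=
  ∑ y : Fin ℓ → X, if ∀ j : M, y j.1 = w j then q y else 0

/-- The generations that agree with `z` at all positions before `n`. -/
def cylinder {ℓ : ℕ} (z : Fin ℓ → X) (n : ℕ) : Finset (Fin ℓ → X) :=
  univ.filter fun y => ∀ s : Fin ℓ, s.1 < n → y s = z s

theorem pref_congr {Y : Type*} {ℓ : ℕ} {y z : Fin ℓ → Y} {t : Fin ℓ}
    (h : ∀ s : Fin ℓ, s.1 < t.1 → y s = z s) : pref y t = pref z t :=
  funext fun s => h ⟨s.1, s.2.trans t.2⟩ s.2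

theorem prod_filter_lt_succ {ℓ : ℕ} (t : Fin ℓ) (f : Fin ℓ → ℝ) :
    ∏ s with s.1 < t.1 + 1, f s = (∏ s with s.1 < t.1, f s) * f t := by
  have h : (univ.filter fun s : Fin ℓ => s.1 < t.1 + 1) =
      insert t (univ.filter fun s : Fin ℓ => s.1 < t.1) := by
    ext s
    simp only [mem_filter, mem_univ, true_and, mem_insert, Fin.ext_iff]
    omega
  rw [h, prod_insert (by simp), mul_comm]

/-- The probability of a prefix is the product of the conditionals along it. -/
theorem sum_cylinder_seqLaw {ℓ : ℕ} (p : AR X ℓ) (hsum : ∀ t pre, ∑ a : X, p t pre a = 1)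
    {n : ℕ} (hn : n ≤ ℓ) (z : Fin ℓ → X) :
    ∑ y ∈ cylinder z n, seqLaw p y = ∏ s with s.1 < n, p s (pref z s) (z s) := by
  induction hn using Nat.decreasingInduction generalizing z with
  | self =>
    have h : cylinder z ℓ = {z} := by
      ext y
      simp [cylinder, funext_iff]
    simp [h, seqLaw]
  | of_succ n hn ih =>
    have hfib : ∀ a : X, (cylinder z n).filter (fun y => y ⟨n, hn⟩ = a) =
        cylinder (Function.update z ⟨n, hn⟩ a) (n + 1) := by
      intro a
      ext y
      simp only [cylinder, mem_filter, mem_univ, true_and]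
      constructor
      · rintro ⟨h, ha⟩ s hs
        rcases eq_or_ne s ⟨n, hn⟩ with rfl | hne
        · simpa using ha
        · have : s.1 ≠ n := fun h => hne (Fin.ext h)
          rw [Function.update_of_ne hne]
          exact h s (by omega)
      · intro h
        refine ⟨fun s hs => ?_, by simpa using h ⟨n, hn⟩ (Nat.lt_succ_self n)⟩
        have hne : s ≠ ⟨n, hn⟩ := by rintro rfl; simp at hs
        rw [h s (by omega), Function.update_of_ne hne]
    have hupd : ∀ (a : X) (t s : Fin ℓ), s.1 < t.1 → Function.update z t a s = z s := by
      intro a t s hs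
      exact Function.update_of_ne (by rintro rfl; simp at hs) _ _
    rw [← sum_fiberwise (cylinder z n) (fun y => y ⟨n, hn⟩)]
    have hterm : ∀ a : X, ∑ y ∈ cylinder z n with y ⟨n, hn⟩ = a, seqLaw p y =
        (∏ s with s.1 < n, p s (pref z s) (z s)) * p ⟨n, hn⟩ (pref z ⟨n, hn⟩) a := by
      intro a
      rw [hfib, ih, prod_filter_lt_succ ⟨n, hn⟩]
      congr 1
      · refine prod_congr rfl fun s hs => ?_
        have hs' : s.1 < n := by simpa using hs
        rw [hupd a ⟨n, hn⟩ s hs', pref_congr fun r hr => hupd a ⟨n, hn⟩ r (hr.trans hs')]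
      · rw [pref_congr fun r hr => hupd a ⟨n, hn⟩ r hr, Function.update_self]
    simp_rw [hterm]
    rw [← mul_sum, hsum, mul_one]

theorem sum_cylinder_succ {ℓ : ℕ} (p : AR X ℓ) (hsum : ∀ t pre, ∑ a : X, p t pre a = 1)
    (t : Fin ℓ) (z : Fin ℓ → X) :
    ∑ y ∈ cylinder z (t.1 + 1), seqLaw p y =
      (∑ y ∈ cylinder z t.1, seqLaw p y) * p t (pref z t) (z t) := by
  rw [sum_cylinder_seqLaw p hsum t.2, sum_cylinder_seqLaw p hsum t.2.le, prod_filter_lt_succ]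

theorem sum_cylinder_pos {ℓ : ℕ} (p : AR X ℓ) (hpos : ∀ t pre a, 0 < p t pre a)
    (z : Fin ℓ → X) (n : ℕ) : 0 < ∑ y ∈ cylinder z n, seqLaw p y :=
  sum_pos (fun _ _ => prod_pos fun _ _ => hpos _ _ _) ⟨z, by simp [cylinder]⟩

/-- If exchanging the coordinates outside `M` preserves the product law of `q` and `r`, then
`q` and `r` have the same conditionals at the positions outside `M`. -/
theorem conditional_eq_of_exchange {ℓ : ℕ} {q r : AR X ℓ}
    (hq : ∀ t pre a, 0 < q t pre a) (hqsum : ∀ t pre, ∑ a : X, q t pre a = 1)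
    (hr : ∀ t pre a, 0 < r t pre a) (hrsum : ∀ t pre, ∑ a : X, r t pre a = 1)
    {M : Finset (Fin ℓ)}
    (hex : ∀ y y' : Fin ℓ → X, seqLaw q y * seqLaw r y' =
      seqLaw q (M.piecewise y y') * seqLaw r (M.piecewise y' y))
    {t : Fin ℓ} (ht : t ∉ M) (pre : Fin t.1 → X) (a : X) : q t pre a = r t pre a := by
  let z : Fin ℓ → X := fun s => if h : s.1 < t.1 then pre ⟨s.1, h⟩ else a
  have hpre : pref z t = pre := by
    funext s
    exact dif_pos s.2
  have hza : z t = a := by simp [z]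
  have key : (∑ y ∈ cylinder z (t.1 + 1), seqLaw q y) * ∑ y ∈ cylinder z t.1, seqLaw r y =
      (∑ y ∈ cylinder z t.1, seqLaw q y) * ∑ y ∈ cylinder z (t.1 + 1), seqLaw r y := by
    have hmem : ∀ y y' : Fin ℓ → X, y ∈ cylinder z (t.1 + 1) → y' ∈ cylinder z t.1 →
        M.piecewise y y' ∈ cylinder z t.1 ∧ M.piecewise y' y ∈ cylinder z (t.1 + 1) := by
      intro y y' hy hy'
      simp only [cylinder, mem_filter, mem_univ, true_and] at hy hy' ⊢
      refine ⟨fun s hs => ?_, fun s hs => ?_⟩ <;> by_cases hsM : s ∈ M <;>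
        simp only [Finset.piecewise, hsM, if_true, if_false]
      · exact hy s (by omega)
      · exact hy' s hs
      · have : s.1 ≠ t.1 := fun h => ht (Fin.ext h ▸ hsM)
        exact hy' s (by omega)
      · exact hy s hs
    have hmem' : ∀ y y' : Fin ℓ → X, y ∈ cylinder z t.1 → y' ∈ cylinder z (t.1 + 1) →
        M.piecewise y y' ∈ cylinder z (t.1 + 1) ∧ M.piecewise y' y ∈ cylinder z t.1 := by
      intro y y' hy hy'
      exact (hmem y' y hy' hy).symm
    rw [sum_mul_sum, sum_mul_sum, ← sum_product', ← sum_product']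
    refine sum_bij' (fun u _ => (M.piecewise u.1 u.2, M.piecewise u.2 u.1))
      (fun u _ => (M.piecewise u.1 u.2, M.piecewise u.2 u.1)) ?_ ?_ ?_ ?_ ?_
    · intro u hu
      rw [mem_product] at hu ⊢
      exact hmem u.1 u.2 hu.1 hu.2
    · intro u hu
      rw [mem_product] at hu ⊢
      exact hmem' u.1 u.2 hu.1 hu.2
    · intro u _
      ext s <;> by_cases hs : s ∈ M <;> simp [hs]
    · intro u _
      ext s <;> by_cases hs : s ∈ M <;> simp [hs]
    · intro u _
      exact hex u.1 u.2
  rw [sum_cylinder_succ q hqsum, sum_cylinder_succ r hrsum, hpre, hza] at key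
  have h1 := sum_cylinder_pos q hq z t.1
  have h2 := sum_cylinder_pos r hr z t.1
  refine mul_left_cancel₀ (mul_pos h1 h2).ne' ?_
  linarith

/-- If `q y = f (y_M) * G (y_{Mᶜ})`, then the marginal of `q` on `Mᶜ` is proportional to `G`. -/
theorem marg_compl_mul_comm {ℓ : ℕ} {q f G : (Fin ℓ → X) → ℝ} {M : Finset (Fin ℓ)}
    (hq : ∀ y, q y = f y * G y)
    (hf : ∀ y y' : Fin ℓ → X, (∀ s ∈ M, y s = y' s) → f y = f y')
    (hG : ∀ y y' : Fin ℓ → X, (∀ s ∉ M, y s = y' s) → G y = G y')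
    (y y' : Fin ℓ → X) :
    marg q Mᶜ (restr y Mᶜ) * G y' = marg q Mᶜ (restr y' Mᶜ) * G y := by
  let C : (Fin ℓ → X) → Finset (Fin ℓ → X) := fun y => univ.filter fun w => ∀ s ∉ M, w s = y s
  have hmarg : ∀ y, marg q Mᶜ (restr y Mᶜ) = (∑ w ∈ C y, f w) * G y := by
    intro y
    rw [sum_mul, sum_filter]
    refine sum_congr rfl fun w _ => ?_
    have hiff : (∀ j : (Mᶜ : Finset (Fin ℓ)), w j.1 = restr y Mᶜ j) ↔ ∀ s ∉ M, w s = y s := by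
      simp [restr]
    by_cases h : ∀ s ∉ M, w s = y s
    · rw [if_pos (hiff.2 h), if_pos h, hq, hG w y h]
    · rw [if_neg (mt hiff.1 h), if_neg h]
  have hconst : ∑ w ∈ C y, f w = ∑ w ∈ C y', f w := by
    refine sum_bij' (fun w _ => M.piecewise w y') (fun w _ => M.piecewise w y) ?_ ?_ ?_ ?_ ?_
    · intro w _
      simp +contextual [C]
    · intro w _
      simp +contextual [C]
    · intro w hw
      simp only [C, mem_filter, mem_univ, true_and] at hw
      ext s
      by_cases hs : s ∈ M <;> simp [hs]
      exact (hw s hs).symm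
    · intro w hw
      simp only [C, mem_filter, mem_univ, true_and] at hw
      ext s
      by_cases hs : s ∈ M <;> simp [hs]
      exact (hw s hs).symm
    · intro w _
      refine hf _ _ fun s hs => ?_
      simp [hs]
  rw [hmarg, hmarg, hconst]
  ring

theorem restr_congr {Y : Type*} {ℓ : ℕ} {y y' : Fin ℓ → Y} {M : Finset (Fin ℓ)}
    (h : ∀ s ∈ M, y s = y' s) : restr y M = restr y' M :=
  funext fun j => h j.1 j.2

/-- The normalizing constant is one and the composed conditional is the active model's. -/
theorem normalizer_one_and_active_model
    {Inp : Type*} (x : Inp) {ℓ k : ℕ}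
    (pb : Inp → AR X ℓ) (p : Fin k → Inp → AR X ℓ)
    -- the models are strictly positive conditional pmfs
    (hbpos : ∀ t pre a, 0 < pb x t pre a)
    (hbsum : ∀ t pre, ∑ a : X, pb x t pre a = 1)
    (hpos : ∀ i t pre a, 0 < p i x t pre a)
    (hsum : ∀ i t pre, ∑ a : X, p i x t pre a = 1)
    -- `(M 0, …, M (k-1), Mb)` is a partition of the positions `[ℓ]`
    (M : Fin k → Finset (Fin ℓ)) (Mb : Finset (Fin ℓ))
    (hdisj : ∀ i j, i ≠ j → Disjoint (M i) (M j))
    (hdisjb : ∀ i, Disjoint (M i) Mb)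
    (hcover : ∀ t : Fin ℓ, t ∈ Mb ∨ ∃ i, t ∈ M i)
    -- factorized conditionals: `p_i(y|x) = p_i(y_{M_i}|x) · p_b(y_{M_i^c}|x)`
    (hfac : ∀ i (y : Fin ℓ → X), seqLaw (p i x) y =
      marg (seqLaw (p i x)) (M i) (restr y (M i)) *
      marg (seqLaw (pb x)) (M i)ᶜ (restr y (M i)ᶜ))
    -- and `p_b(y|x) = p_b(y_{M_b}|x) · ∏ i, p_b(y_{M_i}|x)`
    (hfacb : ∀ y : Fin ℓ → X, seqLaw (pb x) y =
      marg (seqLaw (pb x)) Mb (restr y Mb) *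
      ∏ i, marg (seqLaw (pb x)) (M i) (restr y (M i))) :
    ∀ (t : Fin ℓ) (pre : Fin t.1 → X),
      Zt (pb x) (fun i => p i x) t pre = 1 ∧
      ∀ a : X,
        (t ∈ Mb → selComp (pb x) (fun i => p i x) t pre a = pb x t pre a) ∧
        (∀ i, t ∈ M i → selComp (pb x) (fun i => p i x) t pre a = p i x t pre a) := by
  have hcond : ∀ i t, t ∉ M i → ∀ pre a, p i x t pre a = pb x t pre a := by
    intro i t ht
    refine conditional_eq_of_exchange (hpos i) (hsum i) hbpos hbsum (fun y y' => ?_) ht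
    let f : (Fin ℓ → X) → ℝ := fun y => marg (seqLaw (pb x)) (M i) (restr y (M i))
    let G : (Fin ℓ → X) → ℝ := fun y => marg (seqLaw (pb x)) Mb (restr y Mb) *
      ∏ j ∈ univ.erase i, marg (seqLaw (pb x)) (M j) (restr y (M j))
    have hq : ∀ y, seqLaw (pb x) y = f y * G y := by
      intro y
      rw [hfacb y, ← mul_prod_erase univ _ (mem_univ i)]
      ring
    have hf : ∀ y y' : Fin ℓ → X, (∀ s ∈ M i, y s = y' s) → f y = f y' := by
      intro y y' h
      simp only [f, restr_congr h]
    have hG : ∀ y y' : Fin ℓ → X, (∀ s ∉ M i, y s = y' s) → G y = G y' := by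
      intro y y' h
      have hb : restr y Mb = restr y' Mb :=
        restr_congr fun s hs => h s fun hs' => disjoint_left.1 (hdisjb i) hs' hs
      simp only [G, hb]
      congr 1
      refine prod_congr rfl fun j hj => ?_
      rw [restr_congr fun s hs => h s fun hs' =>
        disjoint_left.1 (hdisj j i (ne_of_mem_erase hj)) hs hs']
    have hcross := marg_compl_mul_comm hq hf hG y y'
    have e1 : restr ((M i).piecewise y y') (M i) = restr y (M i) :=
      restr_congr fun s hs => by simp [hs]
    have e2 : restr ((M i).piecewise y y') (M i)ᶜ = restr y' (M i)ᶜ :=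
      restr_congr fun s hs => by simp [mem_compl.1 hs]
    have e3 : f ((M i).piecewise y' y) = f y' := hf _ _ fun s hs => by simp [hs]
    have e4 : G ((M i).piecewise y' y) = G y := hG _ _ fun s hs => by simp [hs]
    rw [hfac i y, hfac i ((M i).piecewise y y'), hq y', hq ((M i).piecewise y' y), e1, e2, e3, e4]
    linear_combination marg (seqLaw (p i x)) (M i) (restr y (M i)) * f y' * hcross
  intro t pre
  have hactb : t ∈ Mb → ∀ a,
      pb x t pre a * ∏ i, p i x t pre a / pb x t pre a = pb x t pre a := by
    intro ht a
    rw [prod_eq_one, mul_one]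
    intro i _
    rw [hcond i t fun h => disjoint_left.1 (hdisjb i) h ht, div_self (hbpos t pre a).ne']
  have hact : ∀ i, t ∈ M i → ∀ a,
      pb x t pre a * ∏ j, p j x t pre a / pb x t pre a = p i x t pre a := by
    intro i ht a
    rw [prod_eq_single i, mul_div_cancel₀ _ (hbpos t pre a).ne']
    · intro j _ hj
      rw [hcond j t fun h => disjoint_left.1 (hdisj j i hj) h ht, div_self (hbpos t pre a).ne']
    · simp
  have hZ : Zt (pb x) (fun i => p i x) t pre = 1 := by
    rcases hcover t with ht | ⟨i, ht⟩
    · rw [Zt, sum_congr rfl fun a _ => hactb ht a, hbsum]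
    · rw [Zt, sum_congr rfl fun a _ => hact i ht a, hsum]
  refine ⟨hZ, fun a => ⟨fun ht => ?_, fun i ht => ?_⟩⟩
  · rw [selComp, hZ, div_one, hactb ht]
  · rw [selComp, hZ, div_one, hact i ht]

end Stmt2
end

section
/- Suppose the family of autoregressive models (p_1, …, p_k, p_b) over a finite vocabulary 𝒳, conditioned on an input x, satisfies factorized conditionals with partition (M_1, …, M_k, M_b) of the positions [ℓ]. Then the marginal law of the selective composition p̂(· | x) on the coordinates M_i equals the marginal law of p_i(· | x) on M_i for every i ∈ {1,…,k}, and the marginal law of p̂(· | x) on the coordinates M_b equals the marginal law of p_b(· | x) on M_b. -/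
/-!
STATEMENT 3: Under factorized conditionals, the marginal law of the selective composition
on `M i` equals the marginal law of `p i` on `M i` for every `i`, and its marginal law on
`M_b` equals the marginal law of the background model `p_b` on `M_b`.
-/

namespace Stmt3

open Finset

/-- An autoregressive model over vocabulary `X` with generation length `ℓ`. -/
def AR (X : Type*) (ℓ : ℕ) : Type _ :=
  (t : Fin ℓ) → (Fin t.1 → X) → X → ℝ

/-- The prefix `y_{<t}` of a full generation `y`. -/
def pref {X : Type*} {ℓ : ℕ} (y : Fin ℓ → X) (t : Fin ℓ) : Fin t.1 → X :=
  fun s => y ⟨s.1, s.2.trans t.2⟩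

/-- The sequence-level law `p(y|x) = ∏ t, p(y_t | x, y_{<t})`. -/
def seqLaw {X : Type*} {ℓ : ℕ} (p : AR X ℓ) (y : Fin ℓ → X) : ℝ :=
  ∏ t : Fin ℓ, p t (pref y t) (y t)

variable {X : Type*} [Fintype X] [DecidableEq X]

/-- The normalizing constant `Z_t(x, y_{<t})` of the selective composition. -/
noncomputable def Zt {ℓ k : ℕ} (pb : AR X ℓ) (p : Fin k → AR X ℓ)
    (t : Fin ℓ) (pre : Fin t.1 → X) : ℝ :=
  ∑ a : X, pb t pre a * ∏ i, p i t pre a / pb t pre a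

/-- The selective composition. -/
noncomputable def selComp {ℓ k : ℕ} (pb : AR X ℓ) (p : Fin k → AR X ℓ) : AR X ℓ :=
  fun t pre a => (pb t pre a * ∏ i, p i t pre a / pb t pre a) / Zt pb p t pre

/-- Restriction `y ↦ y_M` of a generation to an index set `M`. -/
def restr {ℓ : ℕ} (y : Fin ℓ → X) (M : Finset (Fin ℓ)) : M → X :=
  fun j => y j.1

/-- Marginal law of a distribution `q` on `𝒳^ℓ` on the coordinates in `M`
(the pushforward of `q` under `y ↦ y_M`). -/
noncomputable def marg {ℓ : ℕ} (q : (Fin ℓ → X) → ℝ) (M : Finset (Fin ℓ))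
    (w : M → X) : ℝ :=
  ∑ y : Fin ℓ → X, if ∀ j : M, y j.1 = w j then q y else 0

theorem marg_restr {ℓ : ℕ} (q : (Fin ℓ → X) → ℝ) (S : Finset (Fin ℓ)) (y : Fin ℓ → X) :
    marg q S (restr y S) = ∑ z : Fin ℓ → X, if ∀ j ∈ S, z j = y j then q z else 0 := by
  simp [marg, restr]

/-- Every partial sequence extends to a full one, if there is any full sequence at all. -/
theorem exists_restr_eq {X : Type*} {ℓ : ℕ} [Nonempty (Fin ℓ → X)] (S : Finset (Fin ℓ)) (w : S → X) :
    ∃ y : Fin ℓ → X, restr y S = w := by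
  obtain ⟨y₀⟩ := ‹Nonempty (Fin ℓ → X)›
  refine ⟨fun j => if h : j ∈ S then w ⟨j, h⟩ else y₀ j, ?_⟩
  funext j
  simp [restr]

theorem dependsOn_marg_restr {ℓ : ℕ} (q : (Fin ℓ → X) → ℝ) (S : Finset (Fin ℓ)) :
    DependsOn (fun y => marg q S (restr y S)) (S : Set (Fin ℓ)) := by
  intro y z h
  have : restr y S = restr z S := funext fun j => h j.1 j.2
  simp only [this]

/-- Summing a marginal over all values of its coordinates gives the total mass. -/
theorem sum_marg_restr {ℓ : ℕ} (q : (Fin ℓ → X) → ℝ) (S : Finset (Fin ℓ)) (y : Fin ℓ → X) :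
    (∑ z : Fin ℓ → X, if ∀ j ∈ Sᶜ, z j = y j then marg q S (restr z S) else 0) =
      ∑ u, q u := by
  simp only [marg_restr]
  calc _ = ∑ z : Fin ℓ → X, ∑ u : Fin ℓ → X,
        if z = S.piecewise u y then q u else 0 := by
        refine Finset.sum_congr rfl fun z _ => ?_
        by_cases hz : ∀ j ∈ Sᶜ, z j = y j
        · rw [if_pos hz]
          refine Finset.sum_congr rfl fun u _ => if_congr ?_ rfl rfl
          constructor
          · intro h
            funext j
            by_cases hj : j ∈ S
            · simp [hj, h j hj]
            · simp [hj, hz j (Finset.mem_compl.2 hj)]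
          · rintro rfl j hj
            simp [hj]
        · rw [if_neg hz]
          refine (Finset.sum_eq_zero fun u _ => if_neg ?_).symm
          rintro rfl
          exact hz fun j hj => by simp [Finset.mem_compl.1 hj]
    _ = _ := by
        rw [Finset.sum_comm]
        simp

/-- If `q` is a marginal of a normalized law on `S` times a function of the remaining
coordinates, then that function is the marginal of `q` on the remaining coordinates. -/
theorem marg_compl_of_factor {ℓ : ℕ} {q r D : (Fin ℓ → X) → ℝ} {S : Finset (Fin ℓ)}
    (hD : DependsOn D ((Sᶜ : Finset (Fin ℓ)) : Set (Fin ℓ))) (hr : ∑ u, r u = 1)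
    (hq : ∀ y, q y = marg r S (restr y S) * D y) (y : Fin ℓ → X) :
    marg q Sᶜ (restr y Sᶜ) = D y := by
  rw [marg_restr]
  calc _ = ∑ z : Fin ℓ → X,
        (if ∀ j ∈ Sᶜ, z j = y j then marg r S (restr z S) else 0) * D y := by
        refine Finset.sum_congr rfl fun z _ => ?_
        by_cases hz : ∀ j ∈ Sᶜ, z j = y j
        · rw [if_pos hz, if_pos hz, hq z, hD (x := z) (y := y) fun j hj => hz j hj]
        · rw [if_neg hz, if_neg hz, zero_mul]
    _ = D y := by
        rw [← Finset.sum_mul, sum_marg_restr, hr, one_mul]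

/-- If a normalized `q` is a marginal of a normalized law on `S` times a function of the
remaining coordinates, then the two laws have the same marginal on `S`. -/
theorem marg_of_factor {ℓ : ℕ} {q r D : (Fin ℓ → X) → ℝ} {S : Finset (Fin ℓ)}
    (hD : DependsOn D ((Sᶜ : Finset (Fin ℓ)) : Set (Fin ℓ))) (hr : ∑ u, r u = 1)
    (hq1 : ∑ u, q u = 1) (hq : ∀ y, q y = marg r S (restr y S) * D y) (y : Fin ℓ → X) :
    marg q S (restr y S) = marg r S (restr y S) := by
  have hDm := marg_compl_of_factor hD hr hq
  have h := marg_compl_of_factor (q := q) (r := q) (S := Sᶜ)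
    (D := fun y => marg r S (restr y S))
    (by simpa using dependsOn_marg_restr r S) hq1
    (fun y => by rw [hDm, hq, mul_comm]) y
  rwa [compl_compl] at h

/-- Exchanging the `S`-coordinates of two independent sequences. -/
theorem sum_mul_sum_swap {X : Type*} [Fintype X] {ℓ : ℕ}
    {F₁ F₂ G₁ G₂ : (Fin ℓ → X) → ℝ} {S : Finset (Fin ℓ)}
    (hF₁ : DependsOn F₁ (S : Set (Fin ℓ))) (hF₂ : DependsOn F₂ (S : Set (Fin ℓ)))
    (hG₁ : DependsOn G₁ ((Sᶜ : Finset (Fin ℓ)) : Set (Fin ℓ)))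
    (hG₂ : DependsOn G₂ ((Sᶜ : Finset (Fin ℓ)) : Set (Fin ℓ))) :
    (∑ z, F₁ z * G₁ z) * (∑ z, F₂ z * G₂ z) = (∑ z, F₂ z * G₁ z) * (∑ z, F₁ z * G₂ z) := by
  have hl (u v : Fin ℓ → X) : ∀ j ∈ (S : Set (Fin ℓ)), S.piecewise u v j = u j :=
    fun j hj => by simp [Finset.mem_coe.1 hj]
  have hc (u v : Fin ℓ → X) :
      ∀ j ∈ ((Sᶜ : Finset (Fin ℓ)) : Set (Fin ℓ)), S.piecewise u v j = v j :=
    fun j hj => by simp [Finset.mem_compl.1 (Finset.mem_coe.1 hj)]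
  let σ (u : (Fin ℓ → X) × (Fin ℓ → X)) : (Fin ℓ → X) × (Fin ℓ → X) :=
    (S.piecewise u.2 u.1, S.piecewise u.1 u.2)
  have hσ : Function.Involutive σ := by
    rintro ⟨u, v⟩
    ext j <;> by_cases hj : j ∈ S <;> simp [σ, hj]
  rw [Finset.sum_mul_sum, Finset.sum_mul_sum, ← Finset.sum_product', ← Finset.sum_product',
    Finset.univ_product_univ]
  refine Fintype.sum_equiv hσ.toPerm _ _ ?_
  rintro ⟨u, v⟩
  simp only [Function.Involutive.coe_toPerm, σ]
  rw [hF₂ (hl v u), hG₁ (hc v u), hF₁ (hl u v), hG₂ (hc u v)]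
  ring

/-- The probability of a prefix is the product of its conditional probabilities. -/
theorem sum_seqLaw_prefix {ℓ : ℕ} {p : AR X ℓ} (hp : ∀ t pre, ∑ a : X, p t pre a = 1)
    {n : ℕ} (hn : n ≤ ℓ) (y : Fin ℓ → X) :
    (∑ z : Fin ℓ → X, if ∀ j : Fin ℓ, j.1 < n → z j = y j then seqLaw p z else 0) =
      ∏ s : Fin ℓ, if s.1 < n then p s (pref y s) (y s) else 1 := by
  induction hn using Nat.decreasingInduction generalizing y with
  | self => simp [← funext_iff, seqLaw]
  | of_succ n hn ih =>
    let t : Fin ℓ := ⟨n, hn⟩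
    have hpref (a : X) (s : Fin ℓ) (hs : s.1 ≤ n) :
        pref (Function.update y t a) s = pref y s := by
      funext r
      have : (⟨r.1, r.2.trans s.2⟩ : Fin ℓ) ≠ t := by
        have := r.2
        simp only [t, ne_eq, Fin.mk.injEq]
        omega
      simp [pref, Function.update_of_ne this]
    have hprod (a : X) :
        (∏ s : Fin ℓ, if s.1 < n + 1 then
          p s (pref (Function.update y t a) s) (Function.update y t a s) else 1) =
        (∏ s : Fin ℓ, if s.1 < n then p s (pref y s) (y s) else 1) * p t (pref y t) a := by
      rw [← Finset.mul_prod_erase _ _ (Finset.mem_univ t),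
        ← Finset.mul_prod_erase (f := fun s : Fin ℓ => if s.1 < n then _ else _) _
          (Finset.mem_univ t)]
      have ht : t.1 = n := rfl
      simp only [ht, lt_add_one, lt_irrefl, if_true, if_false, one_mul, hpref a t le_rfl,
        Function.update_self]
      rw [mul_comm]
      congr 1
      refine Finset.prod_congr rfl fun s hs => ?_
      have hst : s ≠ t := (Finset.mem_erase.1 hs).1
      have hsn : s.1 ≠ n := fun h => hst (Fin.ext h)
      by_cases h : s.1 < n
      · rw [if_pos h, if_pos (by omega), hpref a s h.le, Function.update_of_ne hst]
      · rw [if_neg h, if_neg (by omega)]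
    have hsplit (z : Fin ℓ → X) :
        (if ∀ j : Fin ℓ, j.1 < n → z j = y j then seqLaw p z else 0) =
        ∑ a : X, if ∀ j : Fin ℓ, j.1 < n + 1 → z j = Function.update y t a j
          then seqLaw p z else 0 := by
      have hiff (a : X) : (∀ j : Fin ℓ, j.1 < n + 1 → z j = Function.update y t a j) ↔
          z t = a ∧ ∀ j : Fin ℓ, j.1 < n → z j = y j := by
        constructor
        · refine fun h => ⟨by simpa using h t (Nat.lt_succ_self n), fun j hj => ?_⟩
          have hjt : j ≠ t := fun h => hj.ne (congrArg Fin.val h)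
          simpa [Function.update_of_ne hjt] using h j (by omega)
        · rintro ⟨rfl, h⟩ j hj
          by_cases hjt : j = t
          · simp [hjt]
          · have : j.1 ≠ n := fun h => hjt (Fin.ext h)
            rw [Function.update_of_ne hjt]
            exact h j (by omega)
      simp only [hiff, ite_and]
      simp
    simp only [hsplit]
    rw [Finset.sum_comm]
    simp only [ih, hprod]
    rw [← Finset.mul_sum, hp, mul_one]

theorem sum_seqLaw {ℓ : ℕ} {p : AR X ℓ} (hp : ∀ t pre, ∑ a : X, p t pre a = 1) :
    ∑ y, seqLaw p y = 1 := by
  obtain h | ⟨⟨y⟩⟩ := isEmpty_or_nonempty (Fin ℓ → X)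
  · cases ℓ with
    | zero => exact (h.false Fin.elim0).elim
    | succ n =>
      have := isEmpty_fun.1 h
      have hX : IsEmpty X := this.2
      simpa using hp 0 Fin.elim0
  · simpa using sum_seqLaw_prefix hp (Nat.zero_le ℓ) y

theorem seqLaw_pos {X : Type*} {ℓ : ℕ} {p : AR X ℓ} (hp : ∀ t pre a, 0 < p t pre a)
    (y : Fin ℓ → X) : 0 < seqLaw p y :=
  Finset.prod_pos fun _ _ => hp _ _ _

/-- Two models which factorize over `S` and its complement, with the same factor on the
complement, have the same conditionals at the positions outside `S`. -/
theorem conditional_eq_of_factor {ℓ : ℕ} {p q : AR X ℓ}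
    (hp0 : ∀ t pre a, 0 < p t pre a) (hp : ∀ t pre, ∑ a : X, p t pre a = 1)
    (hq0 : ∀ t pre a, 0 < q t pre a) (hq : ∀ t pre, ∑ a : X, q t pre a = 1)
    {S : Finset (Fin ℓ)} {A B C : (Fin ℓ → X) → ℝ}
    (hA : DependsOn A (S : Set (Fin ℓ))) (hC : DependsOn C (S : Set (Fin ℓ)))
    (hB : DependsOn B ((Sᶜ : Finset (Fin ℓ)) : Set (Fin ℓ)))
    (hpAB : ∀ y, seqLaw p y = A y * B y) (hqCB : ∀ y, seqLaw q y = C y * B y)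
    {t : Fin ℓ} (ht : t ∉ S) (pre : Fin t.1 → X) (a : X) : p t pre a = q t pre a := by
  let y : Fin ℓ → X := fun s => if h : s.1 < t.1 then pre ⟨s.1, h⟩ else a
  have hpre : pref y t = pre := by
    funext s
    exact dif_pos s.2
  have hya : y t = a := by simp [y]
  let F (H : (Fin ℓ → X) → ℝ) (z : Fin ℓ → X) : ℝ :=
    if ∀ j ∈ S, j.1 < t.1 → z j = y j then H z else 0
  let G (n : ℕ) (z : Fin ℓ → X) : ℝ :=
    if ∀ j ∈ Sᶜ, j.1 < n → z j = y j then B z else 0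
  have hF {H : (Fin ℓ → X) → ℝ} (hH : DependsOn H (S : Set (Fin ℓ))) :
      DependsOn (F H) (S : Set (Fin ℓ)) := by
    intro u v h
    refine if_congr (forall₂_congr fun j hj => ?_) (hH h) rfl
    rw [h j hj]
  have hG (n : ℕ) : DependsOn (G n) ((Sᶜ : Finset (Fin ℓ)) : Set (Fin ℓ)) := by
    intro u v h
    refine if_congr (forall₂_congr fun j hj => ?_) (hB h) rfl
    rw [h j hj]
  have hFG {r : AR X ℓ} {H : (Fin ℓ → X) → ℝ} (hr : ∀ z, seqLaw r z = H z * B z) {n : ℕ}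
      (h1 : t.1 ≤ n) (h2 : n ≤ t.1 + 1) :
      (∑ z : Fin ℓ → X, if ∀ j : Fin ℓ, j.1 < n → z j = y j then seqLaw r z else 0) =
        ∑ z, F H z * G n z := by
    refine Finset.sum_congr rfl fun z _ => ?_
    have hiff : (∀ j : Fin ℓ, j.1 < n → z j = y j) ↔
        (∀ j ∈ S, j.1 < t.1 → z j = y j) ∧ ∀ j ∈ Sᶜ, j.1 < n → z j = y j := by
      refine ⟨fun h => ⟨fun j _ hj => h j (by omega), fun j _ hj => h j hj⟩,
        fun h j hj => ?_⟩
      by_cases hjS : j ∈ S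
      · have : j.1 ≠ t.1 := fun e => ht (Fin.ext e ▸ hjS)
        exact h.1 j hjS (by omega)
      · exact h.2 j (Finset.mem_compl.2 hjS) hj
    simp only [hiff, F, G, ite_and, hr z]
    split_ifs <;> simp
  have hstep (r : AR X ℓ) :
      (∏ s : Fin ℓ, if s.1 < t.1 + 1 then r s (pref y s) (y s) else 1) =
      (∏ s : Fin ℓ, if s.1 < t.1 then r s (pref y s) (y s) else 1) * r t pre a := by
    rw [← Finset.mul_prod_erase _ _ (Finset.mem_univ t),
      ← Finset.mul_prod_erase (f := fun s : Fin ℓ => if s.1 < t.1 then _ else _) _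
        (Finset.mem_univ t)]
    simp only [lt_add_one, lt_irrefl, if_true, if_false, one_mul, hpre, hya]
    rw [mul_comm]
    congr 1
    refine Finset.prod_congr rfl fun s hs => ?_
    have hst : s.1 ≠ t.1 := fun h => (Finset.mem_erase.1 hs).1 (Fin.ext h)
    exact if_congr (by omega) rfl rfl
  have hne (r : AR X ℓ) (hr : ∀ t pre a, 0 < r t pre a) :
      (∏ s : Fin ℓ, if s.1 < t.1 then r s (pref y s) (y s) else 1) ≠ 0 := by
    refine (Finset.prod_pos fun s _ => ?_).ne'
    split_ifs
    exacts [hr _ _ _, one_pos]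
  have hswap := sum_mul_sum_swap (hF hA) (hF hC) (hG (t.1 + 1)) (hG t.1)
  rw [← hFG hpAB (Nat.le_succ _) le_rfl, ← hFG hqCB le_rfl (Nat.le_succ _),
    ← hFG hqCB (Nat.le_succ _) le_rfl, ← hFG hpAB le_rfl (Nat.le_succ _),
    sum_seqLaw_prefix hp t.2, sum_seqLaw_prefix hp t.2.le,
    sum_seqLaw_prefix hq t.2, sum_seqLaw_prefix hq t.2.le, hstep p, hstep q] at hswap
  refine mul_left_cancel₀ (mul_ne_zero (hne p hp0) (hne q hq0)) ?_
  linear_combination hswap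

/-- Marginals of the composition match the corresponding component models. -/
theorem marginals_of_composition
    {Inp : Type*} (x : Inp) {ℓ k : ℕ}
    (pb : Inp → AR X ℓ) (p : Fin k → Inp → AR X ℓ)
    -- the models are strictly positive conditional pmfs
    (hbpos : ∀ t pre a, 0 < pb x t pre a)
    (hbsum : ∀ t pre, ∑ a : X, pb x t pre a = 1)
    (hpos : ∀ i t pre a, 0 < p i x t pre a)
    (hsum : ∀ i t pre, ∑ a : X, p i x t pre a = 1)
    -- `(M 0, …, M (k-1), Mb)` is a partition of the positions `[ℓ]`
    (M : Fin k → Finset (Fin ℓ)) (Mb : Finset (Fin ℓ))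
    (hdisj : ∀ i j, i ≠ j → Disjoint (M i) (M j))
    (hdisjb : ∀ i, Disjoint (M i) Mb)
    (hcover : ∀ t : Fin ℓ, t ∈ Mb ∨ ∃ i, t ∈ M i)
    -- factorized conditionals: `p_i(y|x) = p_i(y_{M_i}|x) · p_b(y_{M_i^c}|x)`
    (hfac : ∀ i (y : Fin ℓ → X), seqLaw (p i x) y =
      marg (seqLaw (p i x)) (M i) (restr y (M i)) *
      marg (seqLaw (pb x)) (M i)ᶜ (restr y (M i)ᶜ))
    -- and `p_b(y|x) = p_b(y_{M_b}|x) · ∏ i, p_b(y_{M_i}|x)`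
    (hfacb : ∀ y : Fin ℓ → X, seqLaw (pb x) y =
      marg (seqLaw (pb x)) Mb (restr y Mb) *
      ∏ i, marg (seqLaw (pb x)) (M i) (restr y (M i))) :
    (∀ i (w : M i → X),
      marg (seqLaw (selComp (pb x) (fun i => p i x))) (M i) w =
        marg (seqLaw (p i x)) (M i) w) ∧
    (∀ w : Mb → X,
      marg (seqLaw (selComp (pb x) (fun i => p i x))) Mb w =
        marg (seqLaw (pb x)) Mb w) := by
  set P : Fin k → AR X ℓ := fun i => p i x
  set Q : AR X ℓ := pb x
  have : Nonempty (Fin ℓ → X) := by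
    by_contra h
    rw [not_nonempty_iff] at h
    simpa using sum_seqLaw hbsum
  let c (i : Fin k) (y : Fin ℓ → X) : ℝ := marg (seqLaw Q) (M i) (restr y (M i))
  let a (i : Fin k) (y : Fin ℓ → X) : ℝ := marg (seqLaw (P i)) (M i) (restr y (M i))
  let b (y : Fin ℓ → X) : ℝ := marg (seqLaw Q) Mb (restr y Mb)
  have hrest (f : Fin k → (Fin ℓ → X) → ℝ)
      (hf : ∀ i, DependsOn (f i) (M i : Set (Fin ℓ))) (i : Fin k) :
      DependsOn (fun y => b y * ∏ j ∈ univ.erase i, f j y)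
        (((M i)ᶜ : Finset (Fin ℓ)) : Set (Fin ℓ)) := by
    intro y z h
    have hb : b y = b z := dependsOn_marg_restr (seqLaw Q) Mb fun t ht =>
      h t (by simpa using Finset.disjoint_right.1 (hdisjb i) ht)
    have hprod : ∏ j ∈ univ.erase i, f j y = ∏ j ∈ univ.erase i, f j z :=
      Finset.prod_congr rfl fun j hj => hf j fun t ht =>
        h t (by simpa using Finset.disjoint_left.1 (hdisj j i (Finset.mem_erase.1 hj).1) ht)
    simp only [hb, hprod]
  have hcdep i : DependsOn (c i) (M i : Set (Fin ℓ)) := dependsOn_marg_restr _ _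
  have hadep i : DependsOn (a i) (M i : Set (Fin ℓ)) := dependsOn_marg_restr _ _
  have hsplit (f : Fin k → (Fin ℓ → X) → ℝ) (i : Fin k) (y : Fin ℓ → X) :
      b y * ∏ j, f j y = f i y * (b y * ∏ j ∈ univ.erase i, f j y) := by
    rw [← Finset.mul_prod_erase univ (fun j => f j y) (Finset.mem_univ i)]
    ring
  have hQc i y : seqLaw Q y = c i y * marg (seqLaw Q) (M i)ᶜ (restr y (M i)ᶜ) := by
    have hq y : seqLaw Q y = c i y * (b y * ∏ j ∈ univ.erase i, c j y) :=
      (hfacb y).trans (hsplit c i y)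
    rw [marg_compl_of_factor (hrest c hcdep i) (sum_seqLaw hbsum) hq y, hq]
  have hcond i t (ht : t ∉ M i) pre v : P i t pre v = Q t pre v :=
    conditional_eq_of_factor (hpos i) (hsum i) hbpos hbsum (hadep i) (hcdep i)
      (dependsOn_marg_restr (seqLaw Q) (M i)ᶜ) (hfac i) (hQc i) ht pre v
  have hZ t pre : Zt Q P t pre = 1 := by
    unfold Zt
    by_cases h : ∃ i, t ∈ M i
    · obtain ⟨i, hi⟩ := h
      rw [← hsum i t pre]
      refine Finset.sum_congr rfl fun v _ => ?_
      rw [Finset.prod_eq_single i]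
      · exact mul_div_cancel₀ _ (hbpos t pre v).ne'
      · intro j _ hji
        rw [hcond j t (Finset.disjoint_left.1 (hdisj i j hji.symm) hi)]
        exact div_self (hbpos t pre v).ne'
      · simp
    · push Not at h
      rw [← hbsum t pre]
      refine Finset.sum_congr rfl fun v _ => ?_
      rw [Finset.prod_eq_one, mul_one]
      intro j _
      rw [hcond j t (h j)]
      exact div_self (hbpos t pre v).ne'
  have hnorm t pre : ∑ v, selComp Q P t pre v = 1 := by
    simp only [selComp, hZ, div_one]
    exact hZ t pre
  have hlaw y : seqLaw (selComp Q P) y = b y * ∏ i, a i y := by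
    have h1 : seqLaw (selComp Q P) y =
        seqLaw Q y * ∏ i, (seqLaw (P i) y / seqLaw Q y) := by
      simp only [seqLaw, selComp, hZ, div_one, Finset.prod_mul_distrib]
      rw [Finset.prod_comm]
      simp only [Finset.prod_div_distrib]
    have hQ0 := (seqLaw_pos hbpos y).ne'
    have hc0 i : c i y ≠ 0 := left_ne_zero_of_mul (hQc i y ▸ hQ0)
    have hratio i : seqLaw (P i) y / seqLaw Q y = a i y / c i y := by
      have hB := right_ne_zero_of_mul (hQc i y ▸ hQ0)
      rw [hQc i y, show seqLaw (P i) y = a i y * _ from hfac i y, mul_div_mul_right _ _ hB]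
    rw [h1, show seqLaw Q y = b y * ∏ i, c i y from hfacb y]
    rw [show seqLaw Q y = b y * ∏ i, c i y from hfacb y] at hratio
    simp only [hratio, mul_assoc, ← Finset.prod_mul_distrib, mul_div_cancel₀ _ (hc0 _)]
  refine ⟨fun i w => ?_, fun w => ?_⟩
  · obtain ⟨y, rfl⟩ := exists_restr_eq (M i) w
    exact marg_of_factor (hrest a hadep i) (sum_seqLaw (hsum i)) (sum_seqLaw hnorm)
      (fun y => (hlaw y).trans (hsplit a i y)) y
  · obtain ⟨y, rfl⟩ := exists_restr_eq Mb w
    refine marg_of_factor (D := fun y => ∏ i, a i y) ?_ (sum_seqLaw hbsum)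
      (sum_seqLaw hnorm) hlaw y
    intro y z h
    exact Finset.prod_congr rfl fun i _ => hadep i fun t ht =>
      h t (by simpa using Finset.disjoint_left.1 (hdisjb i) ht)

end Stmt3
end

section
/- Suppose the family of autoregressive models (p_1, …, p_k, p_b) over a finite vocabulary 𝒳, conditioned on an input x, satisfies factorized conditionals with partition (M_1, …, M_k, M_b) of the positions [ℓ]. Then under the sequence-level law of the selective composition p̂(· | x), the coordinate blocks y_{M_b}, y_{M_1}, …, y_{M_k} are mutually independent: p̂(y | x) equals the product of the marginal laws of p̂ on M_b, M_1, …, M_k evaluated at the corresponding subsequences of y, for every y ∈ 𝒳^ℓ. -/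
/-!
STATEMENT 4: Under factorized conditionals, the coordinate blocks `y_{M_b}, y_{M_1}, …,
y_{M_k}` are mutually independent under the sequence-level law of the selective
composition: `p̂(y|x)` equals the product of the marginal laws of `p̂` on
`M_b, M_1, …, M_k`, evaluated at the corresponding subsequences of `y`.
-/

namespace Stmt4

open Finset

/-- An autoregressive model over vocabulary `X` with generation length `ℓ`. -/
def AR (X : Type*) (ℓ : ℕ) : Type _ :=
  (t : Fin ℓ) → (Fin t.1 → X) → X → ℝ

/-- The prefix `y_{<t}` of a full generation `y`. -/
def pref {X : Type*} {ℓ : ℕ} (y : Fin ℓ → X) (t : Fin ℓ) : Fin t.1 → X :=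
  fun s => y ⟨s.1, s.2.trans t.2⟩

/-- The sequence-level law `p(y|x) = ∏ t, p(y_t | x, y_{<t})`. -/
def seqLaw {X : Type*} {ℓ : ℕ} (p : AR X ℓ) (y : Fin ℓ → X) : ℝ :=
  ∏ t : Fin ℓ, p t (pref y t) (y t)

variable {X : Type*} [Fintype X] [DecidableEq X]

/-- The normalizing constant `Z_t(x, y_{<t})` of the selective composition. -/
noncomputable def Zt {ℓ k : ℕ} (pb : AR X ℓ) (p : Fin k → AR X ℓ)
    (t : Fin ℓ) (pre : Fin t.1 → X) : ℝ :=
  ∑ a : X, pb t pre a * ∏ i, p i t pre a / pb t pre a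

/-- The selective composition. -/
noncomputable def selComp {ℓ k : ℕ} (pb : AR X ℓ) (p : Fin k → AR X ℓ) : AR X ℓ :=
  fun t pre a => (pb t pre a * ∏ i, p i t pre a / pb t pre a) / Zt pb p t pre

/-- Restriction `y ↦ y_M` of a generation to an index set `M`. -/
def restr {ℓ : ℕ} (y : Fin ℓ → X) (M : Finset (Fin ℓ)) : M → X :=
  fun j => y j.1

/-- Marginal law of a distribution `q` on `𝒳^ℓ` on the coordinates in `M`. -/
noncomputable def marg {ℓ : ℕ} (q : (Fin ℓ → X) → ℝ) (M : Finset (Fin ℓ))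
    (w : M → X) : ℝ :=
  ∑ y : Fin ℓ → X, if ∀ j : M, y j.1 = w j then q y else 0

set_option linter.unusedSectionVars false

/-- The indicator that `z` coincides with `y` on the index set `s`. -/
noncomputable def agree {ℓ : ℕ} (s : Finset (Fin ℓ)) (y z : Fin ℓ → X) : ℝ :=
  if ∀ j ∈ s, z j = y j then 1 else 0

theorem agree_union {ℓ : ℕ} (s t : Finset (Fin ℓ)) (y z : Fin ℓ → X) :
    agree (s ∪ t) y z = agree s y z * agree t y z := by
  unfold agree
  rw [ite_zero_mul_ite_zero]
  simp [or_imp, forall_and]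

theorem agree_inter_mul_inter_compl {ℓ : ℕ} (s M : Finset (Fin ℓ)) (y z : Fin ℓ → X) :
    agree s y z = agree (s ∩ M) y z * agree (s ∩ Mᶜ) y z := by
  rw [← agree_union, ← inter_union_distrib_left, union_compl, inter_univ]

theorem dependsOn_agree {ℓ : ℕ} {s M : Finset (Fin ℓ)} (h : s ⊆ M) (y : Fin ℓ → X) :
    DependsOn (agree s y) (M : Set (Fin ℓ)) := by
  intro z w hzw
  have : (∀ j ∈ s, z j = y j) ↔ ∀ j ∈ s, w j = y j :=
    forall₂_congr fun j hj => by rw [hzw j (mem_coe.2 (h hj))]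
  simp only [agree, this]

theorem agree_congr {ℓ : ℕ} {s : Finset (Fin ℓ)} {y y' : Fin ℓ → X}
    (h : ∀ j ∈ s, y j = y' j) : agree s y = agree s y' := by
  funext z
  have : (∀ j ∈ s, z j = y j) ↔ ∀ j ∈ s, z j = y' j :=
    forall₂_congr fun j hj => by rw [h j hj]
  simp only [agree, this]

theorem sum_agree_univ_mul {ℓ : ℕ} (f : (Fin ℓ → X) → ℝ) (y : Fin ℓ → X) :
    ∑ z, agree univ y z * f z = f y := by
  simp [agree, ← funext_iff]

theorem marg_restr {ℓ : ℕ} (q : (Fin ℓ → X) → ℝ) (M : Finset (Fin ℓ)) (y : Fin ℓ → X) :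
    marg q M (restr y M) = ∑ z, agree M y z * q z := by
  refine sum_congr rfl fun z _ => ?_
  simp [agree, restr]

theorem dependsOn_marg_restr {ℓ : ℕ} (q : (Fin ℓ → X) → ℝ) (M : Finset (Fin ℓ)) :
    DependsOn (fun y => marg q M (restr y M)) (M : Set (Fin ℓ)) := by
  intro y z h
  simp only [marg_restr, agree_congr (s := M) h]

theorem dependsOn_mul {ℓ : ℕ} {f g : (Fin ℓ → X) → ℝ} {s : Set (Fin ℓ)}
    (hf : DependsOn f s) (hg : DependsOn g s) : DependsOn (fun y => f y * g y) s :=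
  fun _ _ h => congr_arg₂ _ (hf h) (hg h)

theorem dependsOn_prod {ℓ : ℕ} {ι : Type*} {T : Finset ι} {f : ι → (Fin ℓ → X) → ℝ}
    {s : Set (Fin ℓ)} (hf : ∀ i ∈ T, DependsOn (f i) s) :
    DependsOn (fun y => ∏ i ∈ T, f i y) s :=
  fun _ _ h => prod_congr rfl fun i hi => hf i hi h

/-- Sums of products of functions of complementary coordinates can exchange their second
factors. -/
theorem sum_mul_sum_swap {ℓ : ℕ} (M : Finset (Fin ℓ)) {A A' B B' : (Fin ℓ → X) → ℝ}
    (hA : DependsOn A (M : Set (Fin ℓ))) (hA' : DependsOn A' (M : Set (Fin ℓ)))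
    (hB : DependsOn B ((Mᶜ : Finset (Fin ℓ)) : Set (Fin ℓ)))
    (hB' : DependsOn B' ((Mᶜ : Finset (Fin ℓ)) : Set (Fin ℓ))) :
    (∑ y, A y * B y) * ∑ y, A' y * B' y = (∑ y, A y * B' y) * ∑ y, A' y * B y := by
  have hinv : Function.Involutive (fun w : (Fin ℓ → X) × (Fin ℓ → X) =>
      (M.piecewise w.1 w.2, M.piecewise w.2 w.1)) := by
    rintro ⟨y, z⟩
    ext j <;> by_cases hj : j ∈ M <;> simp [hj]
  have hM : ∀ {f : (Fin ℓ → X) → ℝ}, DependsOn f (M : Set (Fin ℓ)) →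
      ∀ y z, f (M.piecewise y z) = f y := fun hf y z =>
    hf fun j hj => piecewise_eq_of_mem _ _ _ (mem_coe.1 hj)
  have hMc : ∀ {f : (Fin ℓ → X) → ℝ}, DependsOn f ((Mᶜ : Finset (Fin ℓ)) : Set (Fin ℓ)) →
      ∀ y z, f (M.piecewise y z) = f z := fun hf y z =>
    hf fun j hj => piecewise_eq_of_notMem _ _ _ (mem_compl.1 (mem_coe.1 hj))
  rw [Fintype.sum_mul_sum, Fintype.sum_mul_sum, ← Fintype.sum_prod_type',
    ← Fintype.sum_prod_type', ← Equiv.sum_comp (hinv.toPerm _)]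
  refine sum_congr rfl fun w _ => ?_
  simp only [Function.Involutive.coe_toPerm, hM hA, hM hA', hMc hB, hMc hB']
  ring

/-- A normalized law that splits over `M` and `Mᶜ` makes events on `M` and on `Mᶜ`
independent. -/
theorem sum_mul_mul_of_split {ℓ : ℕ} (M : Finset (Fin ℓ)) {L A B f g : (Fin ℓ → X) → ℝ}
    (hL : ∀ y, L y = A y * B y) (hsum : ∑ y, L y = 1)
    (hA : DependsOn A (M : Set (Fin ℓ)))
    (hB : DependsOn B ((Mᶜ : Finset (Fin ℓ)) : Set (Fin ℓ)))
    (hf : DependsOn f (M : Set (Fin ℓ)))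
    (hg : DependsOn g ((Mᶜ : Finset (Fin ℓ)) : Set (Fin ℓ))) :
    ∑ y, f y * g y * L y = (∑ y, f y * L y) * ∑ y, g y * L y := by
  have h := sum_mul_sum_swap M (dependsOn_mul hf hA) hA (dependsOn_mul hg hB) hB
  have h₁ : ∀ y, f y * A y * (g y * B y) = f y * g y * L y := fun y => by rw [hL]; ring
  have h₂ : ∀ y, f y * A y * B y = f y * L y := fun y => by rw [hL]; ring
  have h₃ : ∀ y, A y * (g y * B y) = g y * L y := fun y => by rw [hL]; ring
  simp only [h₁, h₂, h₃, ← hL, hsum, mul_one] at h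
  exact h

theorem eq_marg_mul_marg_of_split {ℓ : ℕ} (M : Finset (Fin ℓ)) {L A B : (Fin ℓ → X) → ℝ}
    (hL : ∀ y, L y = A y * B y) (hsum : ∑ y, L y = 1)
    (hA : DependsOn A (M : Set (Fin ℓ)))
    (hB : DependsOn B ((Mᶜ : Finset (Fin ℓ)) : Set (Fin ℓ))) (y : Fin ℓ → X) :
    L y = marg L Mᶜ (restr y Mᶜ) * marg L M (restr y M) := by
  have h := sum_mul_mul_of_split M hL hsum hA hB (dependsOn_agree subset_rfl y)
    (dependsOn_agree subset_rfl y)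
  simp only [← agree_union, union_compl, sum_agree_univ_mul] at h
  rw [h, marg_restr, marg_restr, mul_comm]

theorem pref_congr {ℓ : ℕ} {y z : Fin ℓ → X} {t : Fin ℓ} (h : ∀ s < t, y s = z s) :
    pref y t = pref z t :=
  funext fun s => h _ s.2

/-- The mass which the sequence law gives to a prefix is the product of the conditionals along
that prefix. -/
theorem sum_agree_prefix_mul_seqLaw {ℓ : ℕ} {p : AR X ℓ}
    (hsum : ∀ t (y : Fin ℓ → X), ∑ a, p t (pref y t) a = 1) (n : ℕ) (hn : n ≤ ℓ)
    (y : Fin ℓ → X) :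
    ∑ z, agree {s | s.1 < n} y z * seqLaw p z =
      ∏ s : Fin ℓ with s.1 < n, p s (pref y s) (y s) := by
  induction hn using Nat.decreasingInduction generalizing y with
  | self => simp [sum_agree_univ_mul, seqLaw]
  | of_succ n hn ih =>
    set t : Fin ℓ := ⟨n, hn⟩
    have hset : ({s | s.1 < n + 1} : Finset (Fin ℓ)) = insert t ({s | s.1 < n} : Finset _) := by
      ext s
      simp only [mem_filter, mem_univ, true_and, mem_insert, Fin.ext_iff, t]
      omega
    have hnot : t ∉ ({s | s.1 < n} : Finset (Fin ℓ)) := by simp [t]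
    have hne : ∀ s ∈ ({s | s.1 < n} : Finset (Fin ℓ)), s ≠ t := fun s hs h => hnot (h ▸ hs)
    have hupd : ∀ a, ∀ s ∈ ({s | s.1 < n} : Finset (Fin ℓ)), Function.update y t a s = y s :=
      fun a s hs => Function.update_of_ne (hne s hs) _ _
    have hstep : ∀ z, agree {s | s.1 < n} y z =
        ∑ a, agree {s | s.1 < n + 1} (Function.update y t a) z := by
      intro z
      have : ∀ a, agree {s | s.1 < n + 1} (Function.update y t a) z =
          (if z t = a then 1 else 0) * agree {s | s.1 < n} y z := by
        intro a
        rw [hset, insert_eq, agree_union, agree_congr (hupd a)]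
        simp [agree]
      simp only [this, ← sum_mul, Fintype.sum_ite_eq, one_mul]
    simp only [hstep, sum_mul]
    rw [sum_comm]
    simp only [ih]
    have hprod : ∀ a, ∏ s : Fin ℓ with s.1 < n + 1,
        p s (pref (Function.update y t a) s) (Function.update y t a s) =
        p t (pref y t) a * ∏ s : Fin ℓ with s.1 < n, p s (pref y s) (y s) := by
      intro a
      rw [hset, prod_insert hnot, Function.update_self,
        pref_congr (z := y) fun s hs => hupd a s (mem_filter.2 ⟨mem_univ s, hs⟩)]
      congr 1
      refine prod_congr rfl fun s hs => ?_
      rw [hupd a s hs, pref_congr (z := y) fun r hr => hupd a r ?_]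
      simp only [mem_filter, mem_univ, true_and] at hs ⊢
      exact lt_trans hr hs
    simp only [hprod, ← sum_mul, hsum, one_mul]

theorem sum_seqLaw {ℓ : ℕ} {p : AR X ℓ}
    (hsum : ∀ t (y : Fin ℓ → X), ∑ a, p t (pref y t) a = 1) (y : Fin ℓ → X) :
    ∑ z, seqLaw p z = 1 := by
  simpa [agree] using sum_agree_prefix_mul_seqLaw hsum 0 (Nat.zero_le _) y

/-- If the laws of two models split over `M` and `Mᶜ` with the same factor on `M`, then their
conditionals at positions of `M` agree and only see the coordinates in `M`. -/
theorem conditional_eq_of_split {ℓ : ℕ} {p q : AR X ℓ}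
    (hp : ∀ t pre a, 0 < p t pre a) (hq : ∀ t pre a, 0 < q t pre a)
    (hpsum : ∀ t pre, ∑ a, p t pre a = 1) (hqsum : ∀ t pre, ∑ a, q t pre a = 1)
    (M : Finset (Fin ℓ)) {A B B' : (Fin ℓ → X) → ℝ}
    (hpL : ∀ y, seqLaw p y = A y * B y) (hqL : ∀ y, seqLaw q y = A y * B' y)
    (hA : DependsOn A (M : Set (Fin ℓ)))
    (hB : DependsOn B ((Mᶜ : Finset (Fin ℓ)) : Set (Fin ℓ)))
    (hB' : DependsOn B' ((Mᶜ : Finset (Fin ℓ)) : Set (Fin ℓ)))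
    {t : Fin ℓ} (ht : t ∈ M) {y y' : Fin ℓ → X} (hy : ∀ j ∈ M, y j = y' j) :
    p t (pref y t) (y t) = q t (pref y' t) (y' t) := by
  set U : Finset (Fin ℓ) := {s | s.1 < t.1} with hU
  set V : Finset (Fin ℓ) := {s | s.1 < t.1 + 1} with hV
  have hVU : V = insert t U := by
    ext s
    simp only [hU, hV, mem_filter, mem_univ, true_and, mem_insert, Fin.ext_iff]
    omega
  have htU : t ∉ U := by simp [hU]
  have hVM : V ∩ Mᶜ = U ∩ Mᶜ := by
    rw [hVU, insert_inter_of_notMem (by simpa using ht)]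
  have hMy : ∀ s : Finset (Fin ℓ), agree (s ∩ M) y' = agree (s ∩ M) y := fun s =>
    agree_congr fun j hj => (hy j (mem_inter.1 hj).2).symm
  have hswap := sum_mul_sum_swap M
    (dependsOn_mul (dependsOn_agree (inter_subset_right (s₁ := V)) y) hA)
    (dependsOn_mul (dependsOn_agree (inter_subset_right (s₁ := U)) y) hA)
    (dependsOn_mul (dependsOn_agree (inter_subset_right (s₁ := U)) y) hB)
    (dependsOn_mul (dependsOn_agree (inter_subset_right (s₁ := U)) y') hB')
  have hpU := sum_agree_prefix_mul_seqLaw (fun t y => hpsum t (pref y t)) t.1 t.2.le y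
  have hpV := sum_agree_prefix_mul_seqLaw (fun t y => hpsum t (pref y t)) (t.1 + 1) t.2 y
  have hqU := sum_agree_prefix_mul_seqLaw (fun t y => hqsum t (pref y t)) t.1 t.2.le y'
  have hqV := sum_agree_prefix_mul_seqLaw (fun t y => hqsum t (pref y t)) (t.1 + 1) t.2 y'
  rw [← hU] at hpU hqU
  rw [← hV] at hpV hqV
  simp only [agree_inter_mul_inter_compl V M, agree_inter_mul_inter_compl U M, hVM, hMy,
    hpL, hqL, mul_mul_mul_comm] at hpU hpV hqU hqV
  rw [hpU, hpV, hqU, hqV, hVU, prod_insert htU, prod_insert htU] at hswap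
  have hPp : 0 < ∏ s ∈ U, p s (pref y s) (y s) := prod_pos fun _ _ => hp _ _ _
  have hPq : 0 < ∏ s ∈ U, q s (pref y' s) (y' s) := prod_pos fun _ _ => hq _ _ _
  refine mul_right_cancel₀ (mul_pos hPp hPq).ne' ?_
  linear_combination hswap

/-- If each conditional only sees the coordinates in the block of its position, then the blocks
are mutually independent. -/
theorem seqLaw_eq_prod_marg_of_local {ℓ : ℕ} {ι : Type*} [Fintype ι] [DecidableEq ι]
    {p : AR X ℓ} {N : ι → Finset (Fin ℓ)} (hdisj : ∀ i j, i ≠ j → Disjoint (N i) (N j))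
    (hcover : ∀ t, ∃ j, t ∈ N j)
    (hsum : ∀ t (y : Fin ℓ → X), ∑ a, p t (pref y t) a = 1)
    (hloc : ∀ j, ∀ t ∈ N j,
      DependsOn (fun y : Fin ℓ → X => p t (pref y t) (y t)) (N j : Set (Fin ℓ)))
    (y : Fin ℓ → X) :
    seqLaw p y = ∏ j, marg (seqLaw p) (N j) (restr y (N j)) := by
  have hsub : ∀ i j, i ≠ j → N j ⊆ (N i)ᶜ := fun i j hij =>
    subset_compl_iff_disjoint_left.2 (hdisj i j hij)
  have hsum1 := sum_seqLaw hsum y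
  have key : ∀ T : Finset ι, ∑ z, (∏ j ∈ T, agree (N j) y z) * seqLaw p z =
      ∏ j ∈ T, marg (seqLaw p) (N j) (restr y (N j)) := by
    intro T
    induction T using Finset.induction_on with
    | empty => simpa using hsum1
    | insert i T hi ih =>
      have hne : ∀ j ∈ T, i ≠ j := fun j hj h => hi (h ▸ hj)
      simp only [prod_insert hi]
      rw [← ih, marg_restr]
      refine sum_mul_mul_of_split (N i) (fun z => (prod_mul_prod_compl (N i) _).symm) hsum1
        (dependsOn_prod fun t ht => hloc i t ht) (dependsOn_prod fun t ht => ?_)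
        (dependsOn_agree subset_rfl y)
        (dependsOn_prod fun j hj => dependsOn_agree (hsub i j (hne j hj)) y)
      obtain ⟨j, hj⟩ := hcover t
      have hij : i ≠ j := by
        rintro rfl
        exact mem_compl.1 ht hj
      exact (hloc j t hj).mono (coe_subset.2 (hsub i j hij))
  rw [← key univ]
  have : ∀ z, ∏ j, agree (N j) y z = agree univ y z := by
    intro z
    unfold agree
    rw [prod_ite_zero]
    simp only [prod_const_one]
    congr 1
    simp only [mem_univ, true_imp_iff, eq_iff_iff]
    exact ⟨fun h t => (hcover t).elim fun j hj => h j t hj, fun h _ t _ => h t⟩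
  simp only [this, sum_agree_univ_mul]

/-- Mutual independence of the coordinate blocks under the composed law. -/
theorem blocks_mutually_independent_under_composition
    {Inp : Type*} (x : Inp) {ℓ k : ℕ}
    (pb : Inp → AR X ℓ) (p : Fin k → Inp → AR X ℓ)
    -- the models are strictly positive conditional pmfs
    (hbpos : ∀ t pre a, 0 < pb x t pre a)
    (hbsum : ∀ t pre, ∑ a : X, pb x t pre a = 1)
    (hpos : ∀ i t pre a, 0 < p i x t pre a)
    (hsum : ∀ i t pre, ∑ a : X, p i x t pre a = 1)
    -- `(M 0, …, M (k-1), Mb)` is a partition of the positions `[ℓ]`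
    (M : Fin k → Finset (Fin ℓ)) (Mb : Finset (Fin ℓ))
    (hdisj : ∀ i j, i ≠ j → Disjoint (M i) (M j))
    (hdisjb : ∀ i, Disjoint (M i) Mb)
    (hcover : ∀ t : Fin ℓ, t ∈ Mb ∨ ∃ i, t ∈ M i)
    -- factorized conditionals: `p_i(y|x) = p_i(y_{M_i}|x) · p_b(y_{M_i^c}|x)`
    (hfac : ∀ i (y : Fin ℓ → X), seqLaw (p i x) y =
      marg (seqLaw (p i x)) (M i) (restr y (M i)) *
      marg (seqLaw (pb x)) (M i)ᶜ (restr y (M i)ᶜ))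
    -- and `p_b(y|x) = p_b(y_{M_b}|x) · ∏ i, p_b(y_{M_i}|x)`
    (hfacb : ∀ y : Fin ℓ → X, seqLaw (pb x) y =
      marg (seqLaw (pb x)) Mb (restr y Mb) *
      ∏ i, marg (seqLaw (pb x)) (M i) (restr y (M i))) :
    ∀ y : Fin ℓ → X,
      seqLaw (selComp (pb x) (fun i => p i x)) y =
        marg (seqLaw (selComp (pb x) (fun i => p i x))) Mb (restr y Mb) *
        ∏ i, marg (seqLaw (selComp (pb x) (fun i => p i x))) (M i) (restr y (M i)) := by
  intro y
  set q : Option (Fin k) → AR X ℓ := fun j => j.elim (pb x) (fun i => p i x)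
  set N : Option (Fin k) → Finset (Fin ℓ) := fun j => j.elim Mb M
  have hNdisj : ∀ i j, i ≠ j → Disjoint (N i) (N j)
    | none, none, h => absurd rfl h
    | none, some i, _ => (hdisjb i).symm
    | some i, none, _ => hdisjb i
    | some i, some j, h => hdisj i j fun e => h (congrArg some e)
  have hNcover : ∀ t, ∃ j, t ∈ N j := fun t =>
    (hcover t).elim (fun h => ⟨none, h⟩) fun ⟨i, hi⟩ => ⟨some i, hi⟩
  have hbsplit : ∀ j z, seqLaw (pb x) z = marg (seqLaw (pb x)) (N j) (restr z (N j)) *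
      ∏ l ∈ univ.erase j, marg (seqLaw (pb x)) (N l) (restr z (N l)) := by
    intro j z
    rw [mul_prod_erase univ (fun l => marg (seqLaw (pb x)) (N l) (restr z (N l))) (mem_univ j),
      Fintype.prod_option]
    exact hfacb z
  have hbrest : ∀ j, DependsOn (fun z : Fin ℓ → X =>
      ∏ l ∈ univ.erase j, marg (seqLaw (pb x)) (N l) (restr z (N l)))
      (((N j)ᶜ : Finset (Fin ℓ)) : Set (Fin ℓ)) := fun j =>
    dependsOn_prod fun l hl => (dependsOn_marg_restr _ _).mono <| coe_subset.2 <|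
      subset_compl_iff_disjoint_left.2 (hNdisj j l (ne_of_mem_erase hl).symm)
  have hbpair : ∀ i z, seqLaw (pb x) z =
      marg (seqLaw (pb x)) (M i)ᶜ (restr z (M i)ᶜ) *
        marg (seqLaw (pb x)) (M i) (restr z (M i)) := fun i z =>
    eq_marg_mul_marg_of_split (M i) (hbsplit (some i))
      (sum_seqLaw (fun t z => hbsum t (pref z t)) y) (dependsOn_marg_restr _ _)
      (hbrest (some i)) z
  have hout : ∀ i, ∀ t ∉ M i, ∀ z : Fin ℓ → X,
      p i x t (pref z t) (z t) = pb x t (pref z t) (z t) := fun i t ht z =>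
    conditional_eq_of_split (hpos i) hbpos (hsum i) hbsum (M i)ᶜ
      (fun z => (hfac i z).trans (mul_comm _ _)) (hbpair i) (dependsOn_marg_restr _ _)
      (by rw [compl_compl]; exact dependsOn_marg_restr _ _)
      (by rw [compl_compl]; exact dependsOn_marg_restr _ _) (mem_compl.2 ht) fun _ _ => rfl
  have hloc : ∀ j, ∀ t ∈ N j,
      DependsOn (fun z : Fin ℓ → X => q j t (pref z t) (z t)) (N j : Set (Fin ℓ)) := by
    rintro (_ | i) t ht z z' hz
    · exact conditional_eq_of_split hbpos hbpos hbsum hbsum Mb (hbsplit none) (hbsplit none)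
        (dependsOn_marg_restr _ _) (hbrest none) (hbrest none) ht hz
    · exact conditional_eq_of_split (hpos i) (hpos i) (hsum i) (hsum i) (M i) (hfac i) (hfac i)
        (dependsOn_marg_restr _ _) (dependsOn_marg_restr _ _) (dependsOn_marg_restr _ _) ht hz
  have hqsum : ∀ j t pre, ∑ a, q j t pre a = 1
    | none => hbsum
    | some i => hsum i
  have hnum : ∀ j, ∀ t ∈ N j, ∀ z : Fin ℓ → X, pb x t (pref z t) (z t) *
      ∏ i, p i x t (pref z t) (z t) / pb x t (pref z t) (z t) = q j t (pref z t) (z t) := by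
    intro j t ht z
    have hone : ∀ i, some i ≠ j →
        p i x t (pref z t) (z t) / pb x t (pref z t) (z t) = 1 := fun i hi => by
      rw [hout i t (disjoint_right.1 (hNdisj (some i) j hi) ht) z, div_self (hbpos _ _ _).ne']
    cases j with
    | none => rw [prod_eq_one fun i _ => hone i (Option.some_ne_none i), mul_one]; rfl
    | some i =>
      rw [Fintype.prod_eq_single i fun l hl => hone l fun e => hl (Option.some.inj e),
        mul_div_cancel₀ _ (hbpos _ _ _).ne']
      rfl
  have hsel : ∀ j, ∀ t ∈ N j, ∀ (z : Fin ℓ → X) a,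
      selComp (pb x) (fun i => p i x) t (pref z t) a = q j t (pref z t) a := by
    intro j t ht z
    have hnum' : ∀ a, pb x t (pref z t) a *
        ∏ i, p i x t (pref z t) a / pb x t (pref z t) a = q j t (pref z t) a := by
      intro a
      have h := hnum j t ht (Function.update z t a)
      rwa [pref_congr (z := z) fun s hs => Function.update_of_ne hs.ne _ _,
        Function.update_self] at h
    intro a
    simp only [selComp, Zt, hnum', hqsum, div_one]
  have hind := seqLaw_eq_prod_marg_of_local (p := selComp (pb x) (fun i => p i x))
    hNdisj hNcover
    (fun t z => by
      obtain ⟨j, hj⟩ := hNcover t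
      simp only [hsel j t hj, hqsum])
    (fun j t ht => by
      simp only [hsel j t ht]
      exact hloc j t ht) y
  rwa [Fintype.prod_option] at hind

end Stmt4
end

section
/- Suppose the autoregressive models (p_b, p_1, …, p_k) over a finite vocabulary 𝒳 are jointly factorizable on prompt x with pairwise disjoint active index sets I_1, …, I_k ⊆ [ℓ]. Then the sequence-level likelihood of the selective composition p̂ satisfies, for every y_{1:ℓ} ∈ 𝒳^ℓ, ℒ_{p̂}(y_{1:ℓ} | x) = [∏_{t ∉ I_1 ∪ ⋯ ∪ I_k} p_b(y_t | x, y_{<t})] · [∏_{i=1}^k ∏_{t ∈ I_i} p_i(y_t | x, y_{<t})]. In particular, p̂ applies each skill-specific model p_i on its active set I_i and agrees with the base model p_b elsewhere. -/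
/-!
STATEMENT 5: Composition under joint factorizability (Theorem 3.7).
If `(p_b, p_1, …, p_k)` are jointly factorizable on prompt `x` with pairwise disjoint
active index sets `I_1, …, I_k`, then the sequence-level likelihood of the selective
composition is the product of the base model's conditionals off `⋃ i, I i` and each
skill model's conditionals on its own active set.
-/

namespace Stmt5

open Finset

/-- An autoregressive model over vocabulary `X` with generation length `ℓ`. -/
def AR (X : Type*) (ℓ : ℕ) : Type _ :=
  (t : Fin ℓ) → (Fin t.1 → X) → X → ℝ

/-- The prefix `y_{<t}` of a full generation `y`. -/
def pref {X : Type*} {ℓ : ℕ} (y : Fin ℓ → X) (t : Fin ℓ) : Fin t.1 → X :=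
  fun s => y ⟨s.1, s.2.trans t.2⟩

/-- The sequence-level likelihood `ℒ_p(y_{1:ℓ}|x) = ∏ t, p(y_t | x, y_{<t})`. -/
def seqLaw {X : Type*} {ℓ : ℕ} (p : AR X ℓ) (y : Fin ℓ → X) : ℝ :=
  ∏ t : Fin ℓ, p t (pref y t) (y t)

variable {X : Type*} [Fintype X] [DecidableEq X]

/-- The normalizing constant `Z_t(x, y_{<t})` of the selective composition. -/
noncomputable def Zt {ℓ k : ℕ} (pb : AR X ℓ) (p : Fin k → AR X ℓ)
    (t : Fin ℓ) (pre : Fin t.1 → X) : ℝ :=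
  ∑ a : X, pb t pre a * ∏ i, p i t pre a / pb t pre a

/-- The selective composition. -/
noncomputable def selComp {ℓ k : ℕ} (pb : AR X ℓ) (p : Fin k → AR X ℓ) : AR X ℓ :=
  fun t pre a => (pb t pre a * ∏ i, p i t pre a / pb t pre a) / Zt pb p t pre

/-- If the weights `pb t pre a * ∏ i, p i t pre a / pb t pre a` agree with a probability mass
function `q`, then no renormalization takes place and the composition is `q`. -/
theorem selComp_eq_of_weight_eq {X : Type*} [Fintype X] {ℓ k : ℕ} {pb : AR X ℓ}
    {p : Fin k → AR X ℓ} {t : Fin ℓ} {pre : Fin t.1 → X} {q : X → ℝ}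
    (hw : ∀ a, pb t pre a * ∏ i, p i t pre a / pb t pre a = q a) (hq : ∑ a, q a = 1) (a : X) :
    selComp pb p t pre a = q a := by
  simp only [selComp, Zt, hw, hq, div_one]

/-- Where every skill model agrees with the base model, so does the composition. -/
theorem selComp_eq_base {X : Type*} [Fintype X] {ℓ k : ℕ} {pb : AR X ℓ}
    {p : Fin k → AR X ℓ} {t : Fin ℓ} {pre : Fin t.1 → X}
    (hb : ∀ a, pb t pre a ≠ 0) (hsum : ∑ a, pb t pre a = 1)
    (h : ∀ i a, p i t pre a = pb t pre a) (a : X) :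
    selComp pb p t pre a = pb t pre a :=
  selComp_eq_of_weight_eq (fun a => by simp [h, hb a]) hsum a

/-- Where every skill model but the `i`-th agrees with the base model, the composition is the
`i`-th skill model. -/
theorem selComp_eq_skill {X : Type*} [Fintype X] {ℓ k : ℕ} {pb : AR X ℓ}
    {p : Fin k → AR X ℓ} {t : Fin ℓ} {pre : Fin t.1 → X} (i : Fin k)
    (hb : ∀ a, pb t pre a ≠ 0) (hsum : ∑ a, p i t pre a = 1)
    (h : ∀ j, j ≠ i → ∀ a, p j t pre a = pb t pre a) (a : X) :
    selComp pb p t pre a = p i t pre a := by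
  refine selComp_eq_of_weight_eq (fun a => ?_) hsum a
  rw [Finset.prod_eq_single i (fun j _ hj => by rw [h j hj, div_self (hb a)]) (by simp),
    mul_div_cancel₀ _ (hb a)]

/-- **Composition under Joint factorizability.** -/
theorem composition_joint_factorizability
    {Inp : Type*} (x : Inp) {ℓ k : ℕ}
    (pb : Inp → AR X ℓ) (p : Fin k → Inp → AR X ℓ)
    -- the models are strictly positive conditional pmfs
    (hbpos : ∀ t pre a, 0 < pb x t pre a)
    (hbsum : ∀ t pre, ∑ a : X, pb x t pre a = 1)
    (hpos : ∀ i t pre a, 0 < p i x t pre a)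
    (hsum : ∀ i t pre, ∑ a : X, p i x t pre a = 1)
    -- joint factorizability on prompt `x` with active index sets `I i`:
    (I : Fin k → Finset (Fin ℓ))
    (hskill : ∀ i (t : Fin ℓ), t ∉ I i → ∀ (pre : Fin t.1 → X) (a : X),
      p i x t pre a = pb x t pre a)
    (hdisj : ∀ i j, i ≠ j → Disjoint (I i) (I j)) :
    ∀ y : Fin ℓ → X,
      seqLaw (selComp (pb x) (fun i => p i x)) y =
        (∏ t ∈ univ.filter (fun t : Fin ℓ => ∀ i, t ∉ I i),
            pb x t (pref y t) (y t)) *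
        ∏ i, ∏ t ∈ I i, p i x t (pref y t) (y t) := by
  intro y
  simp only [← Fintype.prod_ite_mem (I _), Finset.prod_filter, seqLaw]
  rw [Finset.prod_comm, ← Finset.prod_mul_distrib]
  refine Finset.prod_congr rfl fun t _ => ?_
  have hb : ∀ a, pb x t (pref y t) a ≠ 0 := fun a => (hbpos t _ a).ne'
  by_cases ht : ∀ i, t ∉ I i
  · simp only [ht, not_false_eq_true, implies_true, if_true, if_false, Finset.prod_const_one,
      mul_one]
    exact selComp_eq_base hb (hbsum t _) (fun i => hskill i t (ht i) _) _
  · obtain ⟨i, hi⟩ : ∃ i, t ∈ I i := by simpa using ht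
    have hj : ∀ j, j ≠ i → t ∉ I j := fun j hji =>
      Finset.disjoint_left.mp (hdisj i j hji.symm) hi
    rw [if_neg ht, one_mul, Finset.prod_eq_single i (fun j _ hji => if_neg (hj j hji)) (by simp),
      if_pos hi]
    exact selComp_eq_skill (p := fun i => p i x) i hb (hsum i t _)
      (fun j hji => hskill j t (hj j hji) _) _

end Stmt5
end

section
/- Suppose the autoregressive models (p_b, p_1, …, p_k) over a finite vocabulary 𝒳 are jointly factorizable on prompt x with pairwise disjoint active index sets I_1, …, I_k ⊆ [ℓ]. Then for every position t and every prefix y_{<t}, the normalizing constant of the selective composition equals one, Z_t(x, y_{<t}) = 1, and the composed conditional satisfies p̂(y_t | x, y_{<t}) = p_i(y_t | x, y_{<t}) if t ∈ I_i for some i, and p̂(y_t | x, y_{<t}) = p_b(y_t | x, y_{<t}) if t ∉ I_1 ∪ ⋯ ∪ I_k. -/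
/-!
STATEMENT 6: Under joint factorizability with pairwise disjoint active sets, the
normalizing constant of the selective composition equals one at every position and
prefix, and the composed conditional equals `p_i` on `I_i` and `p_b` off `⋃ i, I i`.
-/

namespace Stmt6

open Finset

/-- An autoregressive model over vocabulary `X` with generation length `ℓ`. -/
def AR (X : Type*) (ℓ : ℕ) : Type _ :=
  (t : Fin ℓ) → (Fin t.1 → X) → X → ℝ

variable {X : Type*} [Fintype X] [DecidableEq X]

/-- The normalizing constant `Z_t(x, y_{<t})` of the selective composition. -/
noncomputable def Zt {ℓ k : ℕ} (pb : AR X ℓ) (p : Fin k → AR X ℓ)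
    (t : Fin ℓ) (pre : Fin t.1 → X) : ℝ :=
  ∑ a : X, pb t pre a * ∏ i, p i t pre a / pb t pre a

/-- The selective composition. -/
noncomputable def selComp {ℓ k : ℕ} (pb : AR X ℓ) (p : Fin k → AR X ℓ) : AR X ℓ :=
  fun t pre a => (pb t pre a * ∏ i, p i t pre a / pb t pre a) / Zt pb p t pre

/-- If exactly one skill is active at a token, the unnormalized composition is that skill. -/
theorem mul_prod_div_eq_of_active {ι : Type*} [Fintype ι] {b : ℝ} (hb : b ≠ 0) {q : ι → ℝ}
    (i : ι) (hq : ∀ j, j ≠ i → q j = b) : b * ∏ j, q j / b = q i := by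
  have hprod : ∏ j, q j / b = q i / b :=
    Fintype.prod_eq_single i fun j hj => by rw [hq j hj, div_self hb]
  rw [hprod, mul_div_cancel₀ _ hb]

/-- If no skill is active at a token, the unnormalized composition is the base model. -/
theorem mul_prod_div_eq_of_inactive {ι : Type*} [Fintype ι] {b : ℝ} (hb : b ≠ 0) {q : ι → ℝ}
    (hq : ∀ j, q j = b) : b * ∏ j, q j / b = b := by
  simp [hq, div_self hb]

/-- Normalizer equals one; the composed conditional is the active skill (or the base). -/
theorem normalizer_one_and_skill_active
    {Inp : Type*} (x : Inp) {ℓ k : ℕ}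
    (pb : Inp → AR X ℓ) (p : Fin k → Inp → AR X ℓ)
    -- the models are strictly positive conditional pmfs
    (hbpos : ∀ t pre a, 0 < pb x t pre a)
    (hbsum : ∀ t pre, ∑ a : X, pb x t pre a = 1)
    (hpos : ∀ i t pre a, 0 < p i x t pre a)
    (hsum : ∀ i t pre, ∑ a : X, p i x t pre a = 1)
    -- joint factorizability on prompt `x` with active index sets `I i`:
    (I : Fin k → Finset (Fin ℓ))
    (hskill : ∀ i (t : Fin ℓ), t ∉ I i → ∀ (pre : Fin t.1 → X) (a : X),
      p i x t pre a = pb x t pre a)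
    (hdisj : ∀ i j, i ≠ j → Disjoint (I i) (I j)) :
    ∀ (t : Fin ℓ) (pre : Fin t.1 → X),
      Zt (pb x) (fun i => p i x) t pre = 1 ∧
      ∀ a : X,
        (∀ i, t ∈ I i → selComp (pb x) (fun i => p i x) t pre a = p i x t pre a) ∧
        ((∀ i, t ∉ I i) → selComp (pb x) (fun i => p i x) t pre a = pb x t pre a) := by
  intro t pre
  have hb : ∀ a, pb x t pre a ≠ 0 := fun a => (hbpos t pre a).ne'
  have hactive : ∀ i, t ∈ I i → ∀ a,
      pb x t pre a * ∏ j, p j x t pre a / pb x t pre a = p i x t pre a := fun i hi a =>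
    mul_prod_div_eq_of_active (q := fun j => p j x t pre a) (hb a) i fun j hj =>
      hskill j t (Finset.disjoint_left.mp (hdisj i j hj.symm) hi) pre a
  have hinactive : (∀ i, t ∉ I i) → ∀ a,
      pb x t pre a * ∏ j, p j x t pre a / pb x t pre a = pb x t pre a := fun h a =>
    mul_prod_div_eq_of_inactive (hb a) fun j => hskill j t (h j) pre a
  have hZ : Zt (pb x) (fun i => p i x) t pre = 1 := by
    by_cases h : ∃ i, t ∈ I i
    · obtain ⟨i, hi⟩ := h
      simp only [Zt, hactive i hi, hsum]
    · push Not at h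
      simp only [Zt, hinactive h, hbsum]
  refine ⟨hZ, fun a => ⟨fun i hi => ?_, fun h => ?_⟩⟩
  · simp only [selComp, hZ, div_one, hactive i hi]
  · simp only [selComp, hZ, div_one, hinactive h]

end Stmt6
end

section
/- The composition operator on probability densities is independent of smooth reparameterization: let D : ℝ^n → ℝ^n be a C¹ diffeomorphism, and let p_1, …, p_k, p_b be probability density functions with respect to Lebesgue measure on ℝ^n that are strictly positive on a common support, such that the unnormalized composition C̃[p_1, …, p_k, p_b](y) = p_b(y)∏_{i=1}^k p_i(y)/p_b(y) has finite positive integral. Denote by q_i(z) = p_i(D^{-1}(z)) · |det(D(D^{-1}))'(z)|⁻¹-type change-of-variables density, i.e., q_i is the density of the pushforward measure D#(p_i dλ). Then the density of the pushforward of the normalized composition, D#(C[p_1, …, p_k, p_b] dλ), equals the normalized composition C[q_1, …, q_k, q_b] of the pushforward densities, Lebesgue-almost everywhere. -/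
/-!
STATEMENT 9: The composition operator on probability densities is independent of smooth
reparameterization.  For a C¹ diffeomorphism `D` of `ℝⁿ` and strictly positive (on a
common support) probability densities `p_1, …, p_k, p_b` w.r.t. Lebesgue measure whose
unnormalized composition has finite positive integral, the pushforward under `D` of the
measure with density `C[p_1, …, p_k, p_b]` is the measure whose density is the
normalized composition `C[q_1, …, q_k, q_b]` of the pushforward densities
`q(z) = p(D⁻¹ z) · |det D'(D⁻¹ z)|⁻¹` (i.e. the densities agree Lebesgue-a.e.).
-/

namespace Stmt9

open Finset MeasureTheory

/-- The unnormalized composition `C̃[p_1, …, p_k, p_b](y) = p_b(y) ∏ i, p_i(y)/p_b(y)`. -/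
noncomputable def Ctilde {S : Type*} {k : ℕ} (p : Fin k → S → ℝ) (pb : S → ℝ) (y : S) : ℝ :=
  pb y * ∏ i, p i y / pb y

/-- The normalized composition: the unnormalized composition divided by its integral. -/
noncomputable def Cnorm {n : ℕ} {k : ℕ}
    (p : Fin k → (Fin n → ℝ) → ℝ) (pb : (Fin n → ℝ) → ℝ) (y : Fin n → ℝ) : ℝ :=
  Ctilde p pb y / ∫ z : Fin n → ℝ, Ctilde p pb z

/-- The change-of-variables density of the pushforward measure `D#(p dλ)`:
`z ↦ p(D⁻¹ z) · |det D'(D⁻¹ z)|⁻¹`. -/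
noncomputable def pushDensity {n : ℕ} (D : (Fin n → ℝ) ≃ (Fin n → ℝ))
    (p : (Fin n → ℝ) → ℝ) (z : Fin n → ℝ) : ℝ :=
  p (D.symm z) * |(fderiv ℝ (⇑D) (D.symm z)).det|⁻¹

theorem det_fderiv_ne_zero {n : ℕ} {D : (Fin n → ℝ) ≃ (Fin n → ℝ)}
    (hD : Differentiable ℝ D) (hDsymm : Differentiable ℝ D.symm) (x : Fin n → ℝ) :
    (fderiv ℝ D x).det ≠ 0 := by
  have hcomp : (fderiv ℝ D.symm (D x)).comp (fderiv ℝ D x) =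
      ContinuousLinearMap.id ℝ (Fin n → ℝ) := by
    rw [← fderiv_comp x (hDsymm _) (hD x), D.symm_comp_self, fderiv_id]
  have hdet : (fderiv ℝ D.symm (D x)).det * (fderiv ℝ D x).det = 1 := by
    have h := congrArg (fun A : (Fin n → ℝ) →L[ℝ] (Fin n → ℝ) => LinearMap.det
      (A : (Fin n → ℝ) →ₗ[ℝ] (Fin n → ℝ))) hcomp
    simpa [ContinuousLinearMap.det, LinearMap.det_comp] using h
  exact right_ne_zero_of_mul_eq_one hdet

theorem abs_det_mul_pushDensity {n : ℕ} {D : (Fin n → ℝ) ≃ (Fin n → ℝ)}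
    (hD : Differentiable ℝ D) (hDsymm : Differentiable ℝ D.symm)
    (g : (Fin n → ℝ) → ℝ) (x : Fin n → ℝ) :
    |(fderiv ℝ D x).det| * pushDensity D g (D x) = g x := by
  have hdet := abs_ne_zero.mpr (det_fderiv_ne_zero hD hDsymm x)
  rw [pushDensity, D.symm_apply_apply]
  field_simp

theorem integral_pushDensity {n : ℕ} {D : (Fin n → ℝ) ≃ (Fin n → ℝ)}
    (hD : Differentiable ℝ D) (hDsymm : Differentiable ℝ D.symm) (g : (Fin n → ℝ) → ℝ) :
    ∫ z, pushDensity D g z = ∫ y, g y := by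
  have h := integral_image_eq_integral_abs_det_fderiv_smul volume MeasurableSet.univ
    (fun x _ => (hD x).hasFDerivAt.hasFDerivWithinAt) D.injective.injOn (pushDensity D g)
  simpa only [Set.image_univ, D.range_eq_univ, Measure.restrict_univ, smul_eq_mul,
    abs_det_mul_pushDensity hD hDsymm] using h

theorem map_withDensity_ofReal {n : ℕ} {D : (Fin n → ℝ) ≃ (Fin n → ℝ)}
    (hD : Differentiable ℝ D) (hDsymm : Differentiable ℝ D.symm) (g : (Fin n → ℝ) → ℝ) :
    Measure.map D (volume.withDensity fun y => ENNReal.ofReal (g y)) =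
      volume.withDensity fun z => ENNReal.ofReal (pushDensity D g z) := by
  have hmeas : Measurable D := hD.continuous.measurable
  ext s hs
  have h := lintegral_image_eq_lintegral_abs_det_fderiv_mul volume (hmeas hs)
    (fun x _ => (hD x).hasFDerivAt.hasFDerivWithinAt) D.injective.injOn
    (fun z => ENNReal.ofReal (pushDensity D g z))
  simp only [← ENNReal.ofReal_mul (abs_nonneg _), abs_det_mul_pushDensity hD hDsymm,
    Set.image_preimage_eq s D.surjective] at h
  rw [Measure.map_apply hmeas hs, withDensity_apply _ (hmeas hs), withDensity_apply _ hs, h]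

theorem Ctilde_pushDensity {n k : ℕ} {D : (Fin n → ℝ) ≃ (Fin n → ℝ)}
    (hD : Differentiable ℝ D) (hDsymm : Differentiable ℝ D.symm)
    (p : Fin k → (Fin n → ℝ) → ℝ) (pb : (Fin n → ℝ) → ℝ) :
    Ctilde (fun i => pushDensity D (p i)) (pushDensity D pb) =
      pushDensity D (Ctilde p pb) := by
  funext z
  have hdet := inv_ne_zero (abs_ne_zero.mpr (det_fderiv_ne_zero hD hDsymm (D.symm z)))
  simp only [Ctilde, pushDensity, mul_div_mul_right _ _ hdet]
  ring

theorem Cnorm_pushDensity {n k : ℕ} {D : (Fin n → ℝ) ≃ (Fin n → ℝ)}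
    (hD : Differentiable ℝ D) (hDsymm : Differentiable ℝ D.symm)
    (p : Fin k → (Fin n → ℝ) → ℝ) (pb : (Fin n → ℝ) → ℝ) :
    Cnorm (fun i => pushDensity D (p i)) (pushDensity D pb) =
      pushDensity D (Cnorm p pb) := by
  funext z
  simp only [Cnorm, Ctilde_pushDensity hD hDsymm, integral_pushDensity hD hDsymm]
  simp only [pushDensity, Cnorm]
  ring

/-- Smooth-reparameterization independence of the composition of densities. -/
theorem composition_diffeomorphism_independent
    {n k : ℕ} (D : (Fin n → ℝ) ≃ (Fin n → ℝ))
    -- `D` is a C¹ diffeomorphism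
    (hD : ContDiff ℝ 1 (⇑D)) (hDsymm : ContDiff ℝ 1 (⇑D.symm))
    (p : Fin k → (Fin n → ℝ) → ℝ) (pb : (Fin n → ℝ) → ℝ)
    -- measurable probability densities w.r.t. Lebesgue measure,
    -- strictly positive on a common support
    (supp : Set (Fin n → ℝ))
    (hpmeas : ∀ i, Measurable (p i)) (hpbmeas : Measurable pb)
    (hppos : ∀ i, ∀ y ∈ supp, 0 < p i y) (hpbpos : ∀ y ∈ supp, 0 < pb y)
    (hpsupp : ∀ i, ∀ y ∉ supp, p i y = 0) (hpbsupp : ∀ y ∉ supp, pb y = 0)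
    (hpint : ∀ i, Integrable (p i)) (hpbint : Integrable pb)
    (hpprob : ∀ i, ∫ y : Fin n → ℝ, p i y = 1) (hpbprob : ∫ y : Fin n → ℝ, pb y = 1)
    -- the unnormalized composition has finite positive integral
    (hCint : Integrable (Ctilde p pb))
    (hCpos : 0 < ∫ y : Fin n → ℝ, Ctilde p pb y) :
    Measure.map (⇑D)
        (volume.withDensity fun y => ENNReal.ofReal (Cnorm p pb y)) =
      volume.withDensity fun z =>
        ENNReal.ofReal
          (Cnorm (fun i => pushDensity D (p i)) (pushDensity D pb) z) := by
  have hdiff := hD.differentiable one_ne_zero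
  have hdiffsymm := hDsymm.differentiable one_ne_zero
  rw [Cnorm_pushDensity hdiff hdiffsymm]
  exact map_withDensity_ofReal hdiff hdiffsymm _

end Stmt9
end

section
/- Task arithmetic in the linear case: let f_b, f_1, …, f_k : ℝ^n → ℝ^m be linear maps satisfying disjoint coordinate factorization with masks M_1, …, M_k ∈ {0,1}^m, and define the merged map f_merged = f_b + ∑_{i=1}^k (f_i − f_b). Then for every x ∈ ℝ^n and every coordinate r ∈ {1,…,m}: if M_i^{(r)} = 1 for some i, then (f_merged(x))^{(r)} = (f_i(x))^{(r)}, and if M_i^{(r)} = 0 for all i, then (f_merged(x))^{(r)} = (f_b(x))^{(r)}. -/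
/-!
STATEMENT 11: Task arithmetic in the linear case.  If the linear maps
`f_b, f_1, …, f_k : ℝⁿ → ℝᵐ` satisfy disjoint coordinate factorization with masks
`M_1, …, M_k ∈ {0,1}ᵐ`, then the merged map `f_b + ∑ i (f_i − f_b)` agrees with `f_i`
on every coordinate selected by `M_i` and with `f_b` on every coordinate selected by
no mask.
-/

namespace Stmt11

open Finset

/-- **Task arithmetic, linear case.** -/
theorem task_arithmetic_linear
    {n m k : ℕ}
    (fb : (Fin n → ℝ) →ₗ[ℝ] (Fin m → ℝ))
    (f : Fin k → (Fin n → ℝ) →ₗ[ℝ] (Fin m → ℝ))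
    -- masks `M_1, …, M_k ∈ {0,1}^m`
    (M : Fin k → Fin m → Bool)
    -- disjointness of the masks
    (hdisj : ∀ i j, i ≠ j → ∀ r : Fin m, M i r = true → M j r = false)
    -- localized deviation: `f_i` agrees with `f_b` off its mask
    (hloc : ∀ i (x : Fin n → ℝ) (r : Fin m), M i r = false → f i x r = fb x r) :
    ∀ (x : Fin n → ℝ) (r : Fin m),
      (∀ i, M i r = true → (fb + ∑ i, (f i - fb)) x r = f i x r) ∧
      ((∀ i, M i r = false) → (fb + ∑ i, (f i - fb)) x r = fb x r) := by
  intro x r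
  have hmerged : (fb + ∑ i, (f i - fb)) x r = fb x r + ∑ i, (f i x r - fb x r) := by
    simp [LinearMap.sum_apply, Finset.sum_apply]
  rw [hmerged]
  refine ⟨fun i hi => ?_, fun h => ?_⟩
  · rw [Finset.sum_eq_single_of_mem i (Finset.mem_univ i) fun j _ hj =>
      sub_eq_zero.mpr (hloc j x r (hdisj i j hj.symm r hi))]
    exact add_sub_cancel _ _
  · rw [Finset.sum_eq_zero fun j _ => sub_eq_zero.mpr (hloc j x r (h j)), add_zero]

end Stmt11
end

section
/- Letter-substitution composition (two-expert instance of correctness of composition): let 𝒳 be a finite vocabulary, ℓ a length, and let M_1, M_2, M_b partition [ℓ]. Let p_b, p_1, p_2 be autoregressive models over 𝒳 conditioned on input x whose sequence-level laws satisfy p_1(y | x) = p_1(y_{M_1} | x) · p_b(y_{M_1^c} | x), p_2(y | x) = p_2(y_{M_2} | x) · p_b(y_{M_2^c} | x), and p_b(y | x) = p_b(y_{M_b} | x) · p_b(y_{M_1} | x) · p_b(y_{M_2} | x). Then the selective composition p̂ of (p_b, p_1, p_2) satisfies p̂(y | x) = p_b(y_{M_b} | x) · p_1(y_{M_1} | x)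 · p_2(y_{M_2} | x) for every y ∈ 𝒳^ℓ; in particular, if p_1 places all its M_1-mass on a deterministic transformation of the input's M_1-segment and p_2 places all its M_2-mass on a deterministic transformation of the input's M_2-segment, then with probability one p̂ performs both transformations simultaneously. -/
/-!
STATEMENT 14: Letter-substitution composition (two-expert instance of correctness of
composition).  Under factorized conditionals for `(p_b, p_1, p_2)` with partition
`(M_1, M_2, M_b)`, the selective composition satisfies
`p̂(y|x) = p_b(y_{M_b}|x) · p_1(y_{M_1}|x) · p_2(y_{M_2}|x)`; in particular, if `p_1`
places all of its `M_1`-mass on a deterministic transformation of the input's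
`M_1`-segment and `p_2` places all of its `M_2`-mass on a deterministic transformation
of the input's `M_2`-segment, then with probability one `p̂` performs both
transformations simultaneously.
-/

namespace Stmt14

open Finset

/-- An autoregressive model over vocabulary `X` with generation length `ℓ`. -/
def AR (X : Type*) (ℓ : ℕ) : Type _ :=
  (t : Fin ℓ) → (Fin t.1 → X) → X → ℝ

/-- The prefix `y_{<t}` of a full generation `y`. -/
def pref {X : Type*} {ℓ : ℕ} (y : Fin ℓ → X) (t : Fin ℓ) : Fin t.1 → X :=
  fun s => y ⟨s.1, s.2.trans t.2⟩

/-- The sequence-level law `p(y|x) = ∏ t, p(y_t | x, y_{<t})`. -/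
def seqLaw {X : Type*} {ℓ : ℕ} (p : AR X ℓ) (y : Fin ℓ → X) : ℝ :=
  ∏ t : Fin ℓ, p t (pref y t) (y t)

variable {X : Type*} [Fintype X] [DecidableEq X]

/-- The normalizing constant of the two-expert selective composition. -/
noncomputable def Zt2 {ℓ : ℕ} (pb p1 p2 : AR X ℓ) (t : Fin ℓ)
    (pre : Fin t.1 → X) : ℝ :=
  ∑ a : X, pb t pre a * (p1 t pre a / pb t pre a) * (p2 t pre a / pb t pre a)

/-- The selective composition of the background `p_b` with two experts `p_1, p_2`. -/
noncomputable def selComp2 {ℓ : ℕ} (pb p1 p2 : AR X ℓ) : AR X ℓ :=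
  fun t pre a =>
    pb t pre a * (p1 t pre a / pb t pre a) * (p2 t pre a / pb t pre a) /
      Zt2 pb p1 p2 t pre

/-- Restriction `y ↦ y_M` of a generation to an index set `M`. -/
def restr {ℓ : ℕ} (y : Fin ℓ → X) (M : Finset (Fin ℓ)) : M → X :=
  fun j => y j.1

/-- Marginal law of a distribution `q` on `𝒳^ℓ` on the coordinates in `M`. -/
noncomputable def marg {ℓ : ℕ} (q : (Fin ℓ → X) → ℝ) (M : Finset (Fin ℓ))
    (w : M → X) : ℝ :=
  ∑ y : Fin ℓ → X, if ∀ j : M, y j.1 = w j then q y else 0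

/-- Marginalizing onto the coordinates of a generation `z`, phrased without subtypes. -/
lemma marg_restr {ℓ : ℕ} (q : (Fin ℓ → X) → ℝ) (M : Finset (Fin ℓ)) (z : Fin ℓ → X) :
    marg q M (restr z M) = ∑ y : Fin ℓ → X, if ∀ j ∈ M, y j = z j then q y else 0 := by
  simp only [marg, restr, Subtype.forall]

lemma marg_restr_congr {ℓ : ℕ} (q : (Fin ℓ → X) → ℝ) {M : Finset (Fin ℓ)}
    {y z : Fin ℓ → X} (h : ∀ j ∈ M, y j = z j) :
    marg q M (restr y M) = marg q M (restr z M) := by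
  congr 1
  funext j
  exact h j.1 j.2

/-- Summing the `M`-marginal over all values of the `M`-segment gives the total mass. -/
lemma sum_marg_restr {ℓ : ℕ} (q : (Fin ℓ → X) → ℝ) (M : Finset (Fin ℓ)) (y : Fin ℓ → X) :
    (∑ z : Fin ℓ → X, if ∀ j ∈ Mᶜ, z j = y j then marg q M (restr z M) else 0) =
      ∑ w, q w := by
  have key : ∀ z w : Fin ℓ → X,
      ((∀ j ∈ Mᶜ, z j = y j) ∧ ∀ j ∈ M, w j = z j) ↔ M.piecewise w y = z := by
    intro z w
    constructor
    · rintro ⟨h1, h2⟩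
      funext j
      by_cases hj : j ∈ M
      · simp [hj, h2 j hj]
      · simp [hj, h1 j (by simpa using hj)]
    · rintro rfl
      refine ⟨fun j hj => ?_, fun j hj => ?_⟩
      · simp [Finset.mem_compl.1 hj]
      · simp [hj]
  calc
    _ = ∑ z : Fin ℓ → X, ∑ w, if M.piecewise w y = z then q w else 0 := by
      refine Finset.sum_congr rfl fun z _ => ?_
      rw [marg_restr]
      by_cases h : ∀ j ∈ Mᶜ, z j = y j
      · rw [if_pos h]
        exact Finset.sum_congr rfl fun w _ =>
          if_congr ((and_iff_right h).symm.trans (key z w)) rfl rfl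
      · rw [if_neg h]
        exact (Finset.sum_eq_zero fun w _ =>
          if_neg fun hw => h ((key z w).2 hw).1).symm
    _ = ∑ w, q w := by
      rw [Finset.sum_comm]
      simp

/-- The mass of the generations that share the first `k` letters of `y`. -/
noncomputable def prefixMass {ℓ : ℕ} (q : (Fin ℓ → X) → ℝ) (k : ℕ) (y : Fin ℓ → X) : ℝ :=
  ∑ z : Fin ℓ → X, if ∀ s : Fin ℓ, s.1 < k → z s = y s then q z else 0

lemma prefixMass_zero {ℓ : ℕ} (q : (Fin ℓ → X) → ℝ) (y : Fin ℓ → X) :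
    prefixMass q 0 y = ∑ z, q z := by
  simp [prefixMass]

lemma prefixMass_eq_sum_update {ℓ : ℕ} (q : (Fin ℓ → X) → ℝ) (t : Fin ℓ) (y : Fin ℓ → X) :
    prefixMass q t y = ∑ a, prefixMass q (t + 1) (Function.update y t a) := by
  have key : ∀ (z : Fin ℓ → X) (a : X),
      (∀ s : Fin ℓ, s.1 < t + 1 → z s = Function.update y t a s) ↔
        z t = a ∧ ∀ s : Fin ℓ, s.1 < t → z s = y s := by
    intro z a
    constructor
    · intro h
      refine ⟨by simpa using h t (by omega), fun s hs => ?_⟩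
      have hne : s ≠ t := fun e => by simp [e] at hs
      simpa [hne] using h s (by omega)
    · rintro ⟨h1, h2⟩ s hs
      by_cases hst : s = t
      · subst hst
        simpa using h1
      · have hv : s.1 ≠ t.1 := fun e => hst (Fin.ext e)
        simpa [hst] using h2 s (by omega)
  simp only [prefixMass, key]
  rw [Finset.sum_comm]
  refine Finset.sum_congr rfl fun z _ => ?_
  simp [ite_and]

lemma pref_congr {X : Type*} {ℓ : ℕ} {y z : Fin ℓ → X} {t : Fin ℓ}
    (h : ∀ s : Fin ℓ, s.1 < t → y s = z s) : pref y t = pref z t :=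
  funext fun s => h ⟨s.1, s.2.trans t.2⟩ s.2

/-- The chain rule for prefixes. -/
lemma prefixMass_seqLaw {ℓ : ℕ} (p : AR X ℓ) (hsum : ∀ t pre, ∑ a : X, p t pre a = 1)
    {k : ℕ} (hk : k ≤ ℓ) (y : Fin ℓ → X) :
    prefixMass (seqLaw p) k y = ∏ s : Fin ℓ, if s.1 < k then p s (pref y s) (y s) else 1 := by
  induction hk using Nat.decreasingInduction generalizing y with
  | self => simp [prefixMass, seqLaw, ← funext_iff]
  | of_succ k hk ih =>
    let t : Fin ℓ := ⟨k, hk⟩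
    have step : ∀ a : X,
        (∏ s : Fin ℓ, if s.1 < k + 1 then
          p s (pref (Function.update y t a) s) (Function.update y t a s) else 1) =
        (∏ s : Fin ℓ, if s.1 < k then p s (pref y s) (y s) else 1) * p t (pref y t) a := by
      intro a
      have hpref : ∀ s : Fin ℓ, s.1 ≤ k → pref (Function.update y t a) s = pref y s := by
        intro s hs
        refine pref_congr fun r hr => Function.update_of_ne ?_ _ _
        rintro rfl
        exact absurd hr (by simp only [t]; omega)
      have hlast : p t (pref y t) a =
          ∏ s : Fin ℓ, if s = t then p t (pref y t) a else 1 := by simp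
      rw [hlast, ← Finset.prod_mul_distrib]
      refine Finset.prod_congr rfl fun s _ => ?_
      by_cases hst : s = t
      · subst hst
        rw [hpref _ le_rfl]
        simp [t]
      · have hv : s.1 ≠ k := fun e => hst (Fin.ext e)
        by_cases hs : s.1 < k
        · rw [if_pos (by omega), if_pos hs, hpref s hs.le]
          simp [hst]
        · rw [if_neg (by omega), if_neg hs]
          simp [hst]
    calc
      prefixMass (seqLaw p) k y
          = ∑ a, prefixMass (seqLaw p) (k + 1) (Function.update y t a) :=
        prefixMass_eq_sum_update _ t y
      _ = _ := by
        simp only [ih, step]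
        rw [← Finset.mul_sum, hsum, mul_one]

lemma sum_seqLaw {ℓ : ℕ} (p : AR X ℓ) (hsum : ∀ t pre, ∑ a : X, p t pre a = 1)
    (y : Fin ℓ → X) : ∑ z, seqLaw p z = 1 := by
  rw [← prefixMass_zero _ y, prefixMass_seqLaw p hsum (Nat.zero_le _)]
  simp

lemma prefixMass_pos {ℓ : ℕ} (p : AR X ℓ) (hpos : ∀ t pre a, 0 < p t pre a)
    (hsum : ∀ t pre, ∑ a : X, p t pre a = 1) {k : ℕ} (hk : k ≤ ℓ) (y : Fin ℓ → X) :
    0 < prefixMass (seqLaw p) k y := by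
  rw [prefixMass_seqLaw p hsum hk]
  refine Finset.prod_pos fun s _ => ?_
  split_ifs
  · exact hpos _ _ _
  · exact one_pos

lemma prefixMass_succ {ℓ : ℕ} (p : AR X ℓ) (hsum : ∀ t pre, ∑ a : X, p t pre a = 1)
    (t : Fin ℓ) (y : Fin ℓ → X) :
    prefixMass (seqLaw p) (t + 1) y =
      prefixMass (seqLaw p) t y * p t (pref y t) (y t) := by
  rw [prefixMass_seqLaw p hsum t.2, prefixMass_seqLaw p hsum t.2.le]
  have hlast : p t (pref y t) (y t) =
      ∏ s : Fin ℓ, if s = t then p s (pref y s) (y s) else 1 := by simp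
  rw [hlast, ← Finset.prod_mul_distrib]
  refine Finset.prod_congr rfl fun s _ => ?_
  by_cases hst : s = t
  · subst hst
    simp
  · have hv : s.1 ≠ t.1 := fun e => hst (Fin.ext e)
    by_cases hs : s.1 < t.1
    · simp [hst, hs, hs.trans (Nat.lt_succ_self _)]
    · simp [hst, hs, show ¬ s.1 < t.1 + 1 by omega]

/-- Swapping the `Mᶜ`-segments of two generations. -/
def swapCompl {X : Type*} {ℓ : ℕ} (M : Finset (Fin ℓ)) :
    (Fin ℓ → X) × (Fin ℓ → X) ≃ (Fin ℓ → X) × (Fin ℓ → X) where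
  toFun u := (M.piecewise u.1 u.2, M.piecewise u.2 u.1)
  invFun u := (M.piecewise u.1 u.2, M.piecewise u.2 u.1)
  left_inv u := by
    ext j <;> by_cases hj : j ∈ M <;> simp [hj]
  right_inv u := by
    ext j <;> by_cases hj : j ∈ M <;> simp [hj]

/-- Two laws with a common `Mᶜ`-factor have the same conditionals at positions outside `M`. -/
lemma prefixMass_succ_mul_comm {ℓ : ℕ} {q r : (Fin ℓ → X) → ℝ} {M : Finset (Fin ℓ)}
    {f g : (M → X) → ℝ} {h : ((Mᶜ : Finset (Fin ℓ)) → X) → ℝ}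
    (hq : ∀ y, q y = f (restr y M) * h (restr y Mᶜ))
    (hr : ∀ y, r y = g (restr y M) * h (restr y Mᶜ))
    {t : Fin ℓ} (ht : t ∉ M) (y : Fin ℓ → X) :
    prefixMass q (t + 1) y * prefixMass r t y =
      prefixMass q t y * prefixMass r (t + 1) y := by
  have hM : ∀ u v : Fin ℓ → X, restr (M.piecewise u v) M = restr u M := fun u v =>
    funext fun j => by simp [restr]
  have hMc : ∀ u v : Fin ℓ → X, restr (M.piecewise u v) Mᶜ = restr v Mᶜ := fun u v =>
    funext fun j => by simp [restr, Finset.mem_compl.1 j.2]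
  have agree : ∀ u v : Fin ℓ → X,
      ((∀ s : Fin ℓ, s.1 < t + 1 → u s = y s) ∧ ∀ s : Fin ℓ, s.1 < t → v s = y s) →
      (∀ s : Fin ℓ, s.1 < t → M.piecewise u v s = y s) ∧
        ∀ s : Fin ℓ, s.1 < t + 1 → M.piecewise v u s = y s := by
    rintro u v ⟨hu, hv⟩
    refine ⟨fun s hs => ?_, fun s hs => ?_⟩
    · by_cases hsM : s ∈ M
      · simp [hsM, hu s (by omega)]
      · simp [hsM, hv s hs]
    · by_cases hsM : s ∈ M
      · have hst : s.1 ≠ t.1 := fun e => ht (Fin.ext e ▸ hsM)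
        simp [hsM, hv s (by omega)]
      · simp [hsM, hu s hs]
  have back : ∀ u v : Fin ℓ → X, M.piecewise (M.piecewise u v) (M.piecewise v u) = u :=
    fun u v => congrArg Prod.fst ((swapCompl M).left_inv (u, v))
  have agree_iff : ∀ u v : Fin ℓ → X,
      ((∀ s : Fin ℓ, s.1 < t + 1 → u s = y s) ∧ ∀ s : Fin ℓ, s.1 < t → v s = y s) ↔
      (∀ s : Fin ℓ, s.1 < t → M.piecewise u v s = y s) ∧
        ∀ s : Fin ℓ, s.1 < t + 1 → M.piecewise v u s = y s := by
    refine fun u v => ⟨agree u v, fun hw => ?_⟩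
    have := agree _ _ hw.symm
    rw [back, back] at this
    exact this.symm
  simp only [prefixMass, Finset.sum_mul_sum, ← Finset.sum_product', Finset.univ_product_univ,
    ite_zero_mul_ite_zero]
  refine Fintype.sum_equiv (swapCompl M) _ _ fun u => ?_
  refine if_congr (agree_iff u.1 u.2) ?_ rfl
  simp only [swapCompl, Equiv.coe_fn_mk, hq, hr, hM, hMc]
  ring

/-- An expert that shares its `Mᶜ`-factor with the background has the background's conditionals
outside `M`. -/
lemma conditional_eq_of_factor {ℓ : ℕ} {p b : AR X ℓ}
    (hppos : ∀ t pre a, 0 < p t pre a) (hpsum : ∀ t pre, ∑ a : X, p t pre a = 1)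
    (hbpos : ∀ t pre a, 0 < b t pre a) (hbsum : ∀ t pre, ∑ a : X, b t pre a = 1)
    {M : Finset (Fin ℓ)} {f g : (M → X) → ℝ} {h : ((Mᶜ : Finset (Fin ℓ)) → X) → ℝ}
    (hp : ∀ y, seqLaw p y = f (restr y M) * h (restr y Mᶜ))
    (hb : ∀ y, seqLaw b y = g (restr y M) * h (restr y Mᶜ))
    {t : Fin ℓ} (ht : t ∉ M) (y : Fin ℓ → X) :
    p t (pref y t) (y t) = b t (pref y t) (y t) := by
  have h1 := prefixMass_succ_mul_comm hp hb ht y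
  rw [prefixMass_succ p hpsum, prefixMass_succ b hbsum] at h1
  have hP := prefixMass_pos p hppos hpsum t.2.le y
  have hB := prefixMass_pos b hbpos hbsum t.2.le y
  refine mul_left_cancel₀ (mul_pos hP hB).ne' ?_
  linear_combination h1

/-- If a law is the product of its `M`-marginal and a factor that only depends on `Mᶜ`, then
that factor is the `Mᶜ`-marginal. -/
lemma marg_compl_eq {ℓ : ℕ} {q : (Fin ℓ → X) → ℝ} {M : Finset (Fin ℓ)}
    {c : (Fin ℓ → X) → ℝ} (hq : ∀ y, q y = marg q M (restr y M) * c y)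
    (hc : ∀ y z : Fin ℓ → X, (∀ j ∈ Mᶜ, y j = z j) → c y = c z)
    (hone : ∑ y, q y = 1) (y : Fin ℓ → X) :
    marg q Mᶜ (restr y Mᶜ) = c y := by
  rw [marg_restr, ← one_mul (c y), ← hone, ← sum_marg_restr q M y, Finset.sum_mul]
  refine Finset.sum_congr rfl fun z _ => ?_
  split_ifs with h
  · rw [← hc z y h]
    exact hq z
  · simp

/-- Every prefix followed by a letter extends to a full generation. -/
lemma exists_extension {X : Type*} {ℓ : ℕ} (t : Fin ℓ) (pre : Fin t.1 → X) (a : X) :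
    ∃ y : Fin ℓ → X, pref y t = pre ∧ y t = a := by
  refine ⟨fun s => if h : s.1 < t.1 then pre ⟨s.1, h⟩ else a, ?_, by simp⟩
  funext s
  simp [pref]

/-- **Letter-substitution composition.** -/
theorem letter_substitution_composition
    {Inp : Type*} (x : Inp) {ℓ : ℕ}
    (pb p1 p2 : Inp → AR X ℓ)
    -- the models are strictly positive conditional pmfs
    (hbpos : ∀ t pre a, 0 < pb x t pre a)
    (hbsum : ∀ t pre, ∑ a : X, pb x t pre a = 1)
    (h1pos : ∀ t pre a, 0 < p1 x t pre a)
    (h1sum : ∀ t pre, ∑ a : X, p1 x t pre a = 1)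
    (h2pos : ∀ t pre a, 0 < p2 x t pre a)
    (h2sum : ∀ t pre, ∑ a : X, p2 x t pre a = 1)
    -- `(M1, M2, Mb)` is a partition of the positions `[ℓ]`
    (M1 M2 Mb : Finset (Fin ℓ))
    (h12 : Disjoint M1 M2) (h1b : Disjoint M1 Mb) (h2b : Disjoint M2 Mb)
    (hcover : ∀ t : Fin ℓ, t ∈ Mb ∨ t ∈ M1 ∨ t ∈ M2)
    -- factorized conditionals
    (hfac1 : ∀ y : Fin ℓ → X, seqLaw (p1 x) y =
      marg (seqLaw (p1 x)) M1 (restr y M1) *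
      marg (seqLaw (pb x)) M1ᶜ (restr y M1ᶜ))
    (hfac2 : ∀ y : Fin ℓ → X, seqLaw (p2 x) y =
      marg (seqLaw (p2 x)) M2 (restr y M2) *
      marg (seqLaw (pb x)) M2ᶜ (restr y M2ᶜ))
    (hfacb : ∀ y : Fin ℓ → X, seqLaw (pb x) y =
      marg (seqLaw (pb x)) Mb (restr y Mb) *
      marg (seqLaw (pb x)) M1 (restr y M1) *
      marg (seqLaw (pb x)) M2 (restr y M2)) :
    -- the composed law factorizes, ...
    (∀ y : Fin ℓ → X,
      seqLaw (selComp2 (pb x) (p1 x) (p2 x)) y =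
        marg (seqLaw (pb x)) Mb (restr y Mb) *
        marg (seqLaw (p1 x)) M1 (restr y M1) *
        marg (seqLaw (p2 x)) M2 (restr y M2)) ∧
    -- ... and if each expert is deterministic on its own segment, with probability one
    -- the composition performs both transformations simultaneously
    (∀ (w1 : M1 → X) (w2 : M2 → X),
      marg (seqLaw (p1 x)) M1 w1 = 1 →
      marg (seqLaw (p2 x)) M2 w2 = 1 →
      (∑ y : Fin ℓ → X,
        if (∀ j : M1, y j.1 = w1 j) ∧ (∀ j : M2, y j.1 = w2 j) then
          seqLaw (selComp2 (pb x) (p1 x) (p2 x)) y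
        else 0) = 1) := by
  have hB : ∀ y : Fin ℓ → X, 0 < seqLaw (pb x) y := fun y =>
    Finset.prod_pos fun t _ => hbpos _ _ _
  have hc1 : ∀ y : Fin ℓ → X, marg (seqLaw (pb x)) M1ᶜ (restr y M1ᶜ) =
      marg (seqLaw (pb x)) Mb (restr y Mb) * marg (seqLaw (pb x)) M2 (restr y M2) := by
    intro y
    refine marg_compl_eq (c := fun y => marg (seqLaw (pb x)) Mb (restr y Mb) *
      marg (seqLaw (pb x)) M2 (restr y M2)) (fun z => ?_) (fun u v huv => ?_)
      (sum_seqLaw _ hbsum y) y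
    · rw [hfacb z]
      ring
    · rw [marg_restr_congr _ fun j hj => huv j
          (Finset.mem_compl.2 (Finset.disjoint_right.1 h1b hj)),
        marg_restr_congr _ fun j hj => huv j
          (Finset.mem_compl.2 (Finset.disjoint_right.1 h12 hj))]
  have hc2 : ∀ y : Fin ℓ → X, marg (seqLaw (pb x)) M2ᶜ (restr y M2ᶜ) =
      marg (seqLaw (pb x)) Mb (restr y Mb) * marg (seqLaw (pb x)) M1 (restr y M1) := by
    intro y
    refine marg_compl_eq (c := fun y => marg (seqLaw (pb x)) Mb (restr y Mb) *
      marg (seqLaw (pb x)) M1 (restr y M1)) (fun z => ?_) (fun u v huv => ?_)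
      (sum_seqLaw _ hbsum y) y
    · rw [hfacb z]
      ring
    · rw [marg_restr_congr _ fun j hj => huv j
          (Finset.mem_compl.2 (Finset.disjoint_right.1 h2b hj)),
        marg_restr_congr _ fun j hj => huv j
          (Finset.mem_compl.2 (Finset.disjoint_left.1 h12 hj))]
  have heq1 : ∀ t ∉ M1, ∀ pre a, p1 x t pre a = pb x t pre a := by
    intro t ht pre a
    obtain ⟨y, rfl, rfl⟩ := exists_extension t pre a
    exact conditional_eq_of_factor h1pos h1sum hbpos hbsum
      (g := marg (seqLaw (pb x)) M1) hfac1 (fun z => by rw [hfacb z, hc1 z]; ring) ht y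
  have heq2 : ∀ t ∉ M2, ∀ pre a, p2 x t pre a = pb x t pre a := by
    intro t ht pre a
    obtain ⟨y, rfl, rfl⟩ := exists_extension t pre a
    exact conditional_eq_of_factor h2pos h2sum hbpos hbsum
      (g := marg (seqLaw (pb x)) M2) hfac2 (fun z => by rw [hfacb z, hc2 z]; ring) ht y
  have hZ : ∀ t pre, Zt2 (pb x) (p1 x) (p2 x) t pre = 1 := by
    intro t pre
    by_cases ht : t ∈ M1
    · rw [← h1sum t pre]
      refine Finset.sum_congr rfl fun a _ => ?_
      have hb := (hbpos t pre a).ne'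
      rw [heq2 t (Finset.disjoint_left.1 h12 ht)]
      field_simp
    · rw [← h2sum t pre]
      refine Finset.sum_congr rfl fun a _ => ?_
      have hb := (hbpos t pre a).ne'
      rw [heq1 t ht]
      field_simp
  have hcomp : ∀ y : Fin ℓ → X, seqLaw (selComp2 (pb x) (p1 x) (p2 x)) y =
      marg (seqLaw (pb x)) Mb (restr y Mb) *
      marg (seqLaw (p1 x)) M1 (restr y M1) *
      marg (seqLaw (p2 x)) M2 (restr y M2) := by
    intro y
    have hmul : seqLaw (selComp2 (pb x) (p1 x) (p2 x)) y * seqLaw (pb x) y =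
        seqLaw (p1 x) y * seqLaw (p2 x) y := by
      simp only [seqLaw, ← Finset.prod_mul_distrib]
      refine Finset.prod_congr rfl fun t _ => ?_
      have hb := (hbpos t (pref y t) (y t)).ne'
      simp only [selComp2, hZ]
      field_simp
    refine mul_right_cancel₀ (hB y).ne' ?_
    rw [hmul, hfac1 y, hfac2 y, hc1 y, hc2 y, hfacb y]
    ring
  refine ⟨hcomp, fun w1 w2 hw1 hw2 => ?_⟩
  obtain ⟨y1, -, hy1⟩ := Finset.exists_ne_zero_of_sum_ne_zero (hw1.trans_ne one_ne_zero)
  obtain ⟨y2, -, hy2⟩ := Finset.exists_ne_zero_of_sum_ne_zero (hw2.trans_ne one_ne_zero)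
  have ha1 : ∀ j : M1, y1 j.1 = w1 j := by
    by_contra h
    exact hy1 (if_neg h)
  have ha2 : ∀ j : M2, y2 j.1 = w2 j := by
    by_contra h
    exact hy2 (if_neg h)
  have hiff : ∀ y : Fin ℓ → X, ((∀ j : M1, y j.1 = w1 j) ∧ ∀ j : M2, y j.1 = w2 j) ↔
      ∀ j ∈ Mbᶜ, y j = M1.piecewise y1 y2 j := by
    intro y
    constructor
    · rintro ⟨h1, h2⟩ j hj
      by_cases hj1 : j ∈ M1
      · simp [hj1, h1 ⟨j, hj1⟩, ← ha1 ⟨j, hj1⟩]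
      · have hj2 : j ∈ M2 :=
          ((hcover j).resolve_left (Finset.mem_compl.1 hj)).resolve_left hj1
        simp [hj1, h2 ⟨j, hj2⟩, ← ha2 ⟨j, hj2⟩]
    · intro h
      refine ⟨fun j => ?_, fun j => ?_⟩
      · rw [h j.1 (Finset.mem_compl.2 (Finset.disjoint_left.1 h1b j.2)), ← ha1 j]
        simp
      · rw [h j.1 (Finset.mem_compl.2 (Finset.disjoint_left.1 h2b j.2)), ← ha2 j]
        simp [Finset.disjoint_right.1 h12 j.2]
  rw [← sum_seqLaw (pb x) hbsum y1, ← sum_marg_restr (seqLaw (pb x)) Mb (M1.piecewise y1 y2)]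
  refine Finset.sum_congr rfl fun y _ => ?_
  rw [← if_congr (hiff y) rfl rfl]
  split_ifs with h
  · rw [hcomp y, show restr y M1 = w1 from funext h.1, show restr y M2 = w2 from funext h.2,
      hw1, hw2, mul_one, mul_one]
  · rfl

end Stmt14
end
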